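/- arXiv:2512.08837 — 5 statements merged into one kernel-verified Lean document; each statement's English description precedes it below -/
import Mathlib

section
/- For all integers 1 ≤ d ≤ k−1, 1 ≤ ℓ ≤ k−1 and q ≥ 2, the Hamiltonicity thresholds satisfy δ_{qd}^{ham}(qk, qℓ) ≤ δ_d^{ham}(k, ℓ). -/
/-- The canonical `k`-uniform `ℓ`-cycle on vertex set `ZMod m`: its edges are the
`m / (k - ℓ)` sets of `k` cyclically consecutive vertices whose starting points are
the multiples of `k - ℓ`.  For `(k - ℓ) ∣ m` and `2 * k - ℓ ≤ m` this is a genuine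
`ℓ`-cycle: consecutive edges intersect in exactly `ℓ` vertices. -/
def cycleGraph (k ℓ m : ℕ) : Finset (Finset (ZMod m)) :=
  (Finset.range (m / (k - ℓ))).image
    (fun i => Finset.image (fun j : Fin k => (((i * (k - ℓ) + (j : ℕ)) : ℕ) : ZMod m))
      Finset.univ)

/-- The `k`-graph on `Fin n` with edge set `E` contains a Hamilton `ℓ`-cycle:
there is a cyclic ordering of all `n` vertices such that all edges of the
corresponding spanning `ℓ`-cycle are edges of `E`. -/
def HamiltonLCycle (k ℓ : ℕ) {n : ℕ} (E : Finset (Finset (Fin n))) : Prop :=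
  2 * k - ℓ ≤ n ∧ (k - ℓ) ∣ n ∧
    ∃ σ : ZMod n ≃ Fin n, ∀ e ∈ cycleGraph k ℓ n, e.image (fun v => σ v) ∈ E

/-- The `k`-graph on `Fin n` with edge set `E` has minimum `d`-degree at least `x`:
every `d`-set of vertices is contained in at least `x` edges. -/
def MinDegGe {n : ℕ} (d : ℕ) (E : Finset (Finset (Fin n))) (x : ℝ) : Prop :=
  ∀ S : Finset (Fin n), S.card = d → x ≤ ((E.filter (fun e => S ⊆ e)).card : ℝ)

/-- `δ` is a valid constant for the minimum `d`-degree threshold for Hamilton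
`ℓ`-cycles in `k`-graphs. -/
def HamMinDegProp (k ℓ d : ℕ) (δ : ℝ) : Prop :=
  ∀ ε : ℝ, 0 < ε → ∃ n₀ : ℕ, ∀ n : ℕ, n₀ ≤ n → (k - ℓ) ∣ n →
    ∀ E : Finset (Finset (Fin n)), (∀ e ∈ E, e.card = k) →
      MinDegGe d E ((δ + ε) * ((n - d).choose (k - d) : ℝ)) →
      HamiltonLCycle k ℓ E

/-- The minimum `d`-degree threshold `δ_d^{ham}(k,ℓ)` for Hamilton `ℓ`-cycles in
`k`-graphs. -/
noncomputable def hamThreshold (k ℓ d : ℕ) : ℝ :=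
  sInf {δ : ℝ | 0 ≤ δ ∧ δ ≤ 1 ∧ HamMinDegProp k ℓ d δ}

/-- `λ(k,ℓ) = 1 / (⌈k/(k-ℓ)⌉ · (k-ℓ))`. -/
noncomputable def lam (k ℓ : ℕ) : ℝ :=
  1 / ((⌈(k : ℝ) / ((k - ℓ : ℕ) : ℝ)⌉₊ : ℝ) * ((k - ℓ : ℕ) : ℝ))

section Counting

open Finset

/-- In a `k`-uniform family, the edges through `S` correspond to the `(k - #S)`-sets disjoint
from `S` that extend `S` to an edge. -/
lemma card_filter_superset_eq {V : Type*} [Fintype V] [DecidableEq V] {k : ℕ}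
    {E : Finset (Finset V)} (hE : ∀ e ∈ E, e.card = k) (S : Finset V) :
    (E.filter (fun e => S ⊆ e)).card =
      ((powersetCard (k - S.card) (univ \ S)).filter (fun R => S ∪ R ∈ E)).card := by
  refine card_bij' (fun e _ => e \ S) (fun R _ => S ∪ R) ?_ ?_ ?_ ?_
  · intro e he
    rw [mem_filter] at he
    rw [mem_filter, mem_powersetCard, card_sdiff_of_subset he.2, hE e he.1,
      union_sdiff_of_subset he.2]
    exact ⟨⟨sdiff_subset_sdiff (subset_univ _) le_rfl, rfl⟩, he.1⟩
  · intro R hR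
    rw [mem_filter] at hR ⊢
    exact ⟨hR.2, subset_union_left⟩
  · intro e he
    exact union_sdiff_of_subset (mem_filter.1 he).2
  · intro R hR
    rw [mem_filter, mem_powersetCard] at hR
    have hd : Disjoint S R := (disjoint_sdiff (s := S) (t := univ)).mono_right hR.1.1
    exact union_sdiff_cancel_left hd

/-- The degree of `S` and the number of non-edges through `S` add up to the total. -/
lemma card_filter_superset_add_card_nonedges {V : Type*} [Fintype V] [DecidableEq V] {k : ℕ}
    {E : Finset (Finset V)} (hE : ∀ e ∈ E, e.card = k) (S : Finset V) :
    (E.filter (fun e => S ⊆ e)).card +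
      ((powersetCard (k - S.card) (univ \ S)).filter (fun R => S ∪ R ∉ E)).card =
      (Fintype.card V - S.card).choose (k - S.card) := by
  rw [card_filter_superset_eq hE S, card_filter_add_card_filter_not, card_powersetCard,
    card_sdiff_of_subset (subset_univ _), card_univ]

lemma choose_le_choose_sub_add (M r t : ℕ) (ht : t ≤ M) :
    M.choose (r + 1) ≤ (M - t).choose (r + 1) + t * (M - 1).choose r := by
  induction t with
  | zero => simp
  | succ t ih =>
    have h := ih (by omega)
    obtain ⟨a, ha⟩ : ∃ a, M - t = a + 1 := ⟨M - t - 1, by omega⟩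
    have h1 : M - (t + 1) = a := by omega
    rw [ha, Nat.choose_succ_succ] at h
    have h2 : a.choose r ≤ (M - 1).choose r := Nat.choose_le_choose r (by omega)
    rw [h1, add_mul, one_mul]
    simp only [Nat.succ_eq_add_one] at h
    omega

/-- Removing few elements from the ground set loses only a small proportion of the `r`-sets. -/
lemma one_sub_mul_choose_le {M r t : ℕ} {θ : ℝ} (hr : 1 ≤ r) (hM : 1 ≤ M) (ht : t ≤ M)
    (h : (r : ℝ) * t ≤ θ * M) :
    (1 - θ) * (M.choose r : ℝ) ≤ ((M - t).choose r : ℝ) := by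
  obtain ⟨r, rfl⟩ : ∃ a, r = a + 1 := ⟨r - 1, by omega⟩
  obtain ⟨M, rfl⟩ : ∃ a, M = a + 1 := ⟨M - 1, by omega⟩
  have h1 := choose_le_choose_sub_add (M + 1) r t ht
  rw [Nat.add_sub_cancel] at h1
  have h1' : ((M + 1).choose (r + 1) : ℝ) ≤
      ((M + 1 - t).choose (r + 1) : ℝ) + t * (M.choose r : ℝ) := by exact_mod_cast h1
  have h2 : ((M + 1 : ℕ) : ℝ) * (M.choose r : ℝ) =
      ((M + 1).choose (r + 1) : ℝ) * ((r + 1 : ℕ) : ℝ) := by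
    exact_mod_cast Nat.add_one_mul_choose_eq M r
  have hMpos : (0 : ℝ) < ((M + 1 : ℕ) : ℝ) := by positivity
  have h3 : (t : ℝ) * (M.choose r : ℝ) ≤ θ * ((M + 1).choose (r + 1) : ℝ) := by
    refine le_of_mul_le_mul_left ?_ hMpos
    calc ((M + 1 : ℕ) : ℝ) * (t * (M.choose r : ℝ))
        = (((r + 1 : ℕ) : ℝ) * t) * ((M + 1).choose (r + 1) : ℝ) := by
          linear_combination (t : ℝ) * h2
      _ ≤ (θ * ((M + 1 : ℕ) : ℝ)) * ((M + 1).choose (r + 1) : ℝ) := by gcongr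
      _ = _ := by ring
  linarith

/-- Two subsets of equal size avoiding `T` are exchanged by a permutation fixing `T` pointwise. -/
lemma exists_perm_fixing_map_eq {X : Type*} [Fintype X] [DecidableEq X] (T K R : Finset X)
    (hK : Disjoint T K) (hR : Disjoint T R) (hKR : K.card = R.card) :
    ∃ ρ : Equiv.Perm X, (∀ x ∈ T, ρ x = x) ∧ K.map ρ.toEmbedding = R := by
  let e : K ≃ R := Finset.equivOfCardEq hKR
  obtain ⟨ρ, hρ⟩ := Equiv.Perm.exists_extending_pair
    (Sum.elim (fun x : T => x.1) (fun x : K => x.1))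
    (Sum.elim (fun x : T => x.1) (fun x : K => (e x).1))
    (Subtype.val_injective.sumElim Subtype.val_injective fun a b h =>
      Finset.disjoint_left.1 hK a.2 (h ▸ b.2))
    (Subtype.val_injective.sumElim (Subtype.val_injective.comp e.injective) fun a b h =>
      Finset.disjoint_left.1 hR a.2 (h ▸ (e b).2))
  have hK' : ∀ x (hx : x ∈ K), ρ x = e ⟨x, hx⟩ := fun x hx => hρ (Sum.inr ⟨x, hx⟩)
  refine ⟨ρ, fun x hx => hρ (Sum.inl ⟨x, hx⟩), eq_of_subset_of_card_le ?_ ?_⟩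
  · intro y hy
    obtain ⟨x, hx, rfl⟩ := mem_map.1 hy
    simp [hK' x hx]
  · rw [card_map, hKR]

/-- A set `A` of bijections is determined on `T` if it is invariant under rearranging the
positions outside `T`. -/
def DeterminedOn {X V : Type*} (T : Finset X) (A : Finset (X ≃ V)) : Prop :=
  ∀ ρ : Equiv.Perm X, (∀ x ∈ T, ρ x = x) → ∀ π ∈ A, ρ.trans π ∈ A

lemma map_trans_eq_of_fixed {X V : Type*} {T : Finset X} {ρ : Equiv.Perm X}
    (hρ : ∀ x ∈ T, ρ x = x) (π : X ≃ V) :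
    T.map (ρ.trans π).toEmbedding = T.map π.toEmbedding := by
  ext v
  simp only [mem_map, Equiv.coe_toEmbedding, Equiv.trans_apply]
  exact exists_congr fun x => and_congr_right fun hx => by rw [hρ x hx]

/-- Conditioned on the values on `T`, the image of `K` is a uniformly random set outside the
image of `T`, so it hits a family of at most `B` sets with proportion at most
`B / (#X - #T).choose #K`. -/
lemma card_filter_map_union_notMem_mul_choose_le {X V : Type*} [Fintype X] [DecidableEq X]
    [Fintype V] [DecidableEq V] (E : Finset (Finset V)) {D T K : Finset X} (hDT : D ⊆ T)
    (hTK : Disjoint T K) {A : Finset (X ≃ V)} (hA : DeterminedOn T A) {B : ℕ}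
    (hB : ∀ π ∈ A, ((powersetCard K.card (univ \ D.map π.toEmbedding)).filter
      (fun R => D.map π.toEmbedding ∪ R ∉ E)).card ≤ B) :
    (A.filter (fun π => (D ∪ K).map π.toEmbedding ∉ E)).card *
      (Fintype.card X - T.card).choose K.card ≤ A.card * B := by
  obtain ⟨𝓡, h𝓡def⟩ : ∃ 𝓡, 𝓡 = powersetCard K.card (univ \ T) := ⟨_, rfl⟩
  have h𝓡 : 𝓡.card = (Fintype.card X - T.card).choose K.card := by
    rw [h𝓡def, card_powersetCard, card_sdiff_of_subset (subset_univ _), card_univ]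
  have hsame : ∀ R ∈ 𝓡, (A.filter (fun π => (D ∪ K).map π.toEmbedding ∉ E)).card ≤
      (A.filter (fun π => (D ∪ R).map π.toEmbedding ∉ E)).card := by
    intro R hR
    rw [h𝓡def, mem_powersetCard] at hR
    have hTR : Disjoint T R := (disjoint_sdiff (s := T) (t := univ)).mono_right hR.1
    obtain ⟨ρ, hρT, hρ⟩ := exists_perm_fixing_map_eq T R K hTR hTK hR.2
    refine card_le_card_of_injOn (fun π => ρ.trans π) ?_ ?_
    · intro π hπ
      rw [mem_coe, mem_filter] at hπ ⊢
      refine ⟨hA ρ hρT π hπ.1, ?_⟩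
      have : (D ∪ R).map (ρ.trans π).toEmbedding = (D ∪ K).map π.toEmbedding := by
        rw [map_union, map_union, map_trans_eq_of_fixed (fun x hx => hρT x (hDT hx)), ← hρ,
          map_map]
        rfl
      rw [this]
      exact hπ.2
    · intro π _ π' _ h
      exact Equiv.ext fun x => by simpa using Equiv.congr_fun h (ρ.symm x)
  calc _ = ∑ _R ∈ 𝓡, (A.filter (fun π => (D ∪ K).map π.toEmbedding ∉ E)).card := by
        rw [sum_const, h𝓡, smul_eq_mul, mul_comm]
    _ ≤ ∑ R ∈ 𝓡, (A.filter (fun π => (D ∪ R).map π.toEmbedding ∉ E)).card :=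
        sum_le_sum hsame
    _ = ∑ π ∈ A, (𝓡.filter (fun R => (D ∪ R).map π.toEmbedding ∉ E)).card := by
        simp only [card_filter]
        exact sum_comm
    _ ≤ ∑ _π ∈ A, B := by
        refine sum_le_sum fun π hπ => le_trans ?_ (hB π hπ)
        refine card_le_card_of_injOn (fun R => R.map π.toEmbedding) ?_
          (Finset.map_injective _).injOn
        intro R hR
        rw [mem_coe, mem_filter, mem_powersetCard] at ⊢
        rw [mem_coe, mem_filter, h𝓡def, mem_powersetCard] at hR
        obtain ⟨⟨hR1, hR2⟩, hR3⟩ := hR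
        refine ⟨⟨?_, by rw [card_map, hR2]⟩, by rwa [← map_union]⟩
        intro v hv
        obtain ⟨x, hx, rfl⟩ := mem_map.1 hv
        refine mem_sdiff.2 ⟨mem_univ _, fun h => ?_⟩
        rw [mem_map_equiv] at h
        exact (mem_sdiff.1 (hR1 hx)).2 (hDT (by simpa using h))
    _ = _ := by rw [sum_const, smul_eq_mul]

/-- The number of ways to choose successively `s` members of `F`, each disjoint from `T` and from
the earlier choices. -/
def seqCount {α : Type*} [DecidableEq α] (F : Finset (Finset α)) : ℕ → Finset α → ℕ
  | 0, _ => 1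
  | s + 1, T => ∑ K ∈ F.filter (Disjoint T), seqCount F s (T ∪ K)

lemma pow_le_seqCount {α : Type*} [DecidableEq α] {F : Finset (Finset α)} {r t : ℕ} {b : ℝ}
    (hb : 0 ≤ b) (hF : ∀ K ∈ F, K.card = r) {D : Finset α}
    (h : ∀ T : Finset α, D ⊆ T → T.card ≤ t → b ≤ ((F.filter (Disjoint T)).card : ℝ)) (s : ℕ)
    (T : Finset α) (hDT : D ⊆ T) (hT : T.card + s * r ≤ t) : b ^ s ≤ (seqCount F s T : ℝ) := by
  induction s generalizing T with
  | zero => simp [seqCount]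
  | succ s ih =>
    have hT' : T.card + s * r + r ≤ t := by rw [add_mul] at hT; omega
    rw [seqCount, Nat.cast_sum]
    calc b ^ (s + 1) = b * b ^ s := pow_succ' b s
      _ ≤ ((F.filter (Disjoint T)).card : ℝ) * b ^ s := by
          gcongr
          exact h T hDT (by omega)
      _ = ∑ _K ∈ F.filter (Disjoint T), b ^ s := by rw [sum_const, nsmul_eq_mul]
      _ ≤ _ := by
          refine sum_le_sum fun K hK => ih (T ∪ K) (hDT.trans subset_union_left) ?_
          have := card_union_le T K
          rw [hF K (mem_filter.1 hK).1] at this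
          omega

/-- The `r`-sets of groups that do not extend the groups in `D` to an edge under the
arrangement `π` of the vertices into groups. -/
def nonLink {α β V : Type*} [Fintype α] [DecidableEq α] [Fintype β] [DecidableEq V]
    (E : Finset (Finset V)) (r : ℕ) (D : Finset α) (π : α × β ≃ V) : Finset (Finset α) :=
  (powersetCard r (univ \ D)).filter
    (fun K => ((D ∪ K) ×ˢ (univ : Finset β)).map π.toEmbedding ∉ E)

lemma sum_seqCount_nonLink_le {α β V : Type*} [Fintype α] [DecidableEq α] [Fintype β]
    [DecidableEq β] [Fintype V] [DecidableEq V] (E : Finset (Finset V)) {D : Finset α}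
    {r t B : ℕ} {a : ℝ} (ha : 0 ≤ a)
    (hB : ∀ S : Finset V, S.card = D.card * Fintype.card β →
      ((powersetCard (r * Fintype.card β) (univ \ S)).filter (fun R => S ∪ R ∉ E)).card ≤ B)
    (hpos : 0 < ((Fintype.card α - t) * Fintype.card β).choose (r * Fintype.card β))
    (haB : (B : ℝ) ≤
      a * (((Fintype.card α - t) * Fintype.card β).choose (r * Fintype.card β) : ℝ))
    (s : ℕ) (T : Finset α) (hDT : D ⊆ T) (hT : T.card + s * r ≤ t) (A : Finset (α × β ≃ V))
    (hA : DeterminedOn (T ×ˢ (univ : Finset β)) A) :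
    ∑ π ∈ A, (seqCount (nonLink E r D π) s T : ℝ) ≤
      A.card * (((Fintype.card α - D.card).choose r : ℝ) * a) ^ s := by
  induction s generalizing T A with
  | zero => simp [seqCount]
  | succ s ih =>
    have hT' : T.card + s * r + r ≤ t := by rw [add_mul] at hT; omega
    let 𝓚 := (powersetCard r (univ \ D)).filter (Disjoint T)
    let P : Finset α → (α × β ≃ V) → Prop :=
      fun K π => ((D ∪ K) ×ˢ (univ : Finset β)).map π.toEmbedding ∉ E
    have hcard : (𝓚.card : ℝ) ≤ ((Fintype.card α - D.card).choose r : ℝ) := by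
      refine Nat.cast_le.2 ((card_filter_le _ _).trans ?_)
      rw [card_powersetCard, card_sdiff_of_subset (subset_univ _), card_univ]
    have hswap : ∑ π ∈ A, (seqCount (nonLink E r D π) (s + 1) T : ℝ) =
        ∑ K ∈ 𝓚, ∑ π ∈ A.filter (P K), (seqCount (nonLink E r D π) s (T ∪ K) : ℝ) := by
      simp only [sum_filter (s := A)]
      rw [sum_comm]
      refine sum_congr rfl fun π _ => ?_
      rw [seqCount, Nat.cast_sum, ← sum_filter, nonLink, filter_comm]
    have hbound : ∀ K ∈ 𝓚, ((A.filter (P K)).card : ℝ) ≤ a * A.card := by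
      intro K hK
      obtain ⟨hK1, hTK⟩ := mem_filter.1 hK
      obtain ⟨-, hKr⟩ := mem_powersetCard.1 hK1
      have key := card_filter_map_union_notMem_mul_choose_le E (D := D ×ˢ (univ : Finset β))
        (T := T ×ˢ univ) (K := K ×ˢ univ) (product_subset_product_left hDT)
        (disjoint_product.2 (Or.inl hTK)) hA (B := B) (fun π _ => by
          rw [card_product, card_univ, hKr]
          exact hB _ (by rw [card_map, card_product, card_univ]))
      rw [← union_product, card_product, card_product, card_univ, hKr, Fintype.card_prod,
        ← Nat.sub_mul] at key
      have hmono : ((Fintype.card α - t) * Fintype.card β).choose (r * Fintype.card β) ≤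
          ((Fintype.card α - T.card) * Fintype.card β).choose (r * Fintype.card β) :=
        Nat.choose_le_choose _ (Nat.mul_le_mul_right _ (by omega))
      have key' : ((A.filter (P K)).card : ℝ) *
          (((Fintype.card α - T.card) * Fintype.card β).choose (r * Fintype.card β) : ℝ) ≤
          A.card * B := by exact_mod_cast key
      refine le_of_mul_le_mul_right ?_ (Nat.cast_pos (α := ℝ).2 hpos)
      calc _ ≤ ((A.filter (P K)).card : ℝ) *
          (((Fintype.card α - T.card) * Fintype.card β).choose (r * Fintype.card β) : ℝ) := by
            gcongr
        _ ≤ A.card * B := key'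
        _ ≤ A.card * (a * _) := by gcongr
        _ = _ := by ring
    have hdet : ∀ K, DeterminedOn ((T ∪ K) ×ˢ (univ : Finset β)) (A.filter (P K)) := by
      intro K ρ hρ π hπ
      obtain ⟨hπA, hπ⟩ := mem_filter.1 hπ
      refine mem_filter.2 ⟨hA ρ (fun x hx => hρ x ?_) π hπA, ?_⟩
      · exact product_subset_product_left subset_union_left hx
      · simp only [P]
        rwa [map_trans_eq_of_fixed fun x hx => hρ x
          (product_subset_product_left (union_subset_union_left hDT) hx)]
    rw [hswap]
    calc _ ≤ ∑ K ∈ 𝓚, (a * A.card) * (((Fintype.card α - D.card).choose r : ℝ) * a) ^ s := by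
          refine sum_le_sum fun K hK => ?_
          refine (ih (T ∪ K) (hDT.trans subset_union_left) ?_ _ (hdet K)).trans ?_
          · have := card_union_le T K
            rw [(mem_powersetCard.1 (mem_filter.1 hK).1).2] at this
            omega
          · gcongr
            exact hbound K hK
      _ = 𝓚.card * ((a * A.card) * (((Fintype.card α - D.card).choose r : ℝ) * a) ^ s) := by
          rw [sum_const, nsmul_eq_mul]
      _ ≤ ((Fintype.card α - D.card).choose r : ℝ) *
          ((a * A.card) * (((Fintype.card α - D.card).choose r : ℝ) * a) ^ s) := by gcongr
      _ = _ := by ring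

end Counting

section BlowUp

open Finset

/-- The `k`-graph on the groups whose edges are the `k`-sets of groups with union in `E`. -/
def squash {α β V : Type*} [Fintype α] [DecidableEq α] [Fintype β] [DecidableEq V]
    (E : Finset (Finset V)) (k : ℕ) (π : α × β ≃ V) : Finset (Finset α) :=
  (powersetCard k univ).filter (fun K => (K ×ˢ (univ : Finset β)).map π.toEmbedding ∈ E)

/-- Division with remainder by `q` identifies `ZMod (q * n)` with `ZMod n × Fin q`. -/
lemma exists_zmod_mul_equiv (q n : ℕ) (hq : 0 < q) (hn : 0 < n) :
    ∃ τ : ZMod (q * n) ≃ ZMod n × Fin q,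
      ∀ x : ℕ, τ (x : ZMod (q * n)) = (((x / q : ℕ) : ZMod n), ⟨x % q, Nat.mod_lt _ hq⟩) := by
  have : NeZero n := ⟨hn.ne'⟩
  have : NeZero (q * n) := ⟨(Nat.mul_pos hq hn).ne'⟩
  let f : ZMod (q * n) → ZMod n × Fin q :=
    fun v => (((v.val / q : ℕ) : ZMod n), ⟨v.val % q, Nat.mod_lt _ hq⟩)
  have hf : ∀ x : ℕ, f (x : ZMod (q * n)) =
      (((x / q : ℕ) : ZMod n), ⟨x % q, Nat.mod_lt _ hq⟩) := by
    intro x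
    simp only [f, ZMod.val_natCast, Nat.mod_mul_right_div_self, Nat.mod_mul_right_mod,
      ZMod.natCast_mod]
  have hbij : Function.Bijective f := by
    rw [Fintype.bijective_iff_surjective_and_card]
    refine ⟨?_, by simp [ZMod.card, mul_comm]⟩
    rintro ⟨u, j⟩
    refine ⟨((u.val * q + j : ℕ) : ZMod (q * n)), ?_⟩
    rw [hf]
    have h1 : (u.val * q + j) / q = u.val := by
      rw [mul_comm, Nat.mul_add_div hq, Nat.div_eq_of_lt j.2, add_zero]
    have h2 : (u.val * q + j) % q = j := by
      rw [mul_comm, Nat.mul_add_mod, Nat.mod_eq_of_lt j.2]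
    simp only [h1, h2, ZMod.natCast_val, ZMod.cast_id', id_eq]
  exact ⟨Equiv.ofBijective f hbij, hf⟩

/-- A Hamilton `ℓ`-cycle on the groups blows up to a Hamilton `qℓ`-cycle on the vertices. -/
lemma HamiltonLCycle.of_squash {k ℓ q n : ℕ} (hℓk : ℓ < k) (hq : 0 < q)
    {E : Finset (Finset (Fin (q * n)))} (π : Fin n × Fin q ≃ Fin (q * n))
    (h : HamiltonLCycle k ℓ (squash E k π)) : HamiltonLCycle (q * k) (q * ℓ) E := by
  obtain ⟨hn, hdvd, σ, hσ⟩ := h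
  obtain ⟨τ, hτ⟩ := exists_zmod_mul_equiv q n hq (by omega)
  refine ⟨?_, ?_, τ.trans ((σ.prodCongr (Equiv.refl _)).trans π), ?_⟩
  · have := Nat.mul_le_mul_left q hn
    rwa [Nat.mul_sub, mul_left_comm] at this
  · rw [← Nat.mul_sub]
    exact Nat.mul_dvd_mul_left q hdvd
  · intro e he
    rw [cycleGraph, mem_image] at he
    obtain ⟨i, hi, rfl⟩ := he
    rw [mem_range, ← Nat.mul_sub, Nat.mul_div_mul_left _ _ hq] at hi
    have hmem := hσ _ (mem_image_of_mem _ (mem_range.2 hi))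
    convert (mem_filter.1 hmem).2 using 1
    have hval : ∀ j : ℕ, τ ((i * (q * k - q * ℓ) + j : ℕ) : ZMod (q * n)) =
        (((i * (k - ℓ) + j / q : ℕ) : ZMod n), ⟨j % q, Nat.mod_lt _ hq⟩) := by
      intro j
      have h1 : i * (q * k - q * ℓ) + j = q * (i * (k - ℓ)) + j := by
        rw [← Nat.mul_sub, mul_left_comm]
      rw [hτ]
      congr 2
      · rw [h1, Nat.mul_add_div hq]
      · rw [h1, Nat.mul_add_mod]
    ext v
    simp only [mem_image, mem_univ, true_and, exists_exists_eq_and, mem_map, mem_product,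
      and_true, Equiv.trans_apply, Prod.exists, Equiv.coe_toEmbedding, hval,
      Equiv.prodCongr_apply, Prod.map_apply, Equiv.refl_apply]
    constructor
    · rintro ⟨j, rfl⟩
      exact ⟨_, _, ⟨⟨j / q, Nat.div_lt_of_lt_mul j.2⟩, rfl⟩, rfl⟩
    · rintro ⟨_, b, ⟨a, rfl⟩, rfl⟩
      have hlt : q * a + b < q * k := by
        calc q * a + b < q * a + q := by omega
          _ = q * (a + 1) := by ring
          _ ≤ q * k := Nat.mul_le_mul_left q a.2
      refine ⟨⟨q * a + b, hlt⟩, ?_⟩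
      have h1 : (q * (a : ℕ) + b) / q = a := by
        rw [Nat.mul_add_div hq, Nat.div_eq_of_lt b.2, add_zero]
      have h2 : (q * (a : ℕ) + b) % q = b := by
        rw [Nat.mul_add_mod, Nat.mod_eq_of_lt b.2]
      simp only [h1, h2]

end BlowUp

section Random

open Finset

/-- Few arrangements leave a fixed set `D` of groups with more than the expected number of
non-edges. -/
lemma card_filter_lt_nonLink_le {α β V : Type*} [Fintype α] [DecidableEq α] [Fintype β]
    [DecidableEq β] [Fintype V] [DecidableEq V] (E : Finset (Finset V)) {D : Finset α}
    {r s t B : ℕ} {a x θ ρ : ℝ} (ha : 0 ≤ a)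
    (hB : ∀ S : Finset V, S.card = D.card * Fintype.card β →
      ((powersetCard (r * Fintype.card β) (univ \ S)).filter (fun R => S ∪ R ∉ E)).card ≤ B)
    (hpos : 0 < ((Fintype.card α - t) * Fintype.card β).choose (r * Fintype.card β))
    (haB : (B : ℝ) ≤
      a * (((Fintype.card α - t) * Fintype.card β).choose (r * Fintype.card β) : ℝ))
    (ht : D.card + s * r ≤ t) (hc : 0 < (Fintype.card α - D.card).choose r)
    (hθ : (1 - θ) * ((Fintype.card α - D.card).choose r : ℝ) ≤
      ((Fintype.card α - t).choose r : ℝ))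
    (hx : 0 < x - θ) (hρ : a ≤ ρ * (x - θ)) :
    (((univ : Finset (α × β ≃ V)).filter (fun π =>
      x * ((Fintype.card α - D.card).choose r : ℝ) < ((nonLink E r D π).card : ℝ))).card : ℝ) ≤
      (Fintype.card (α × β ≃ V) : ℝ) * ρ ^ s := by
  set c : ℝ := ((Fintype.card α - D.card).choose r : ℝ) with hc_def
  have hc' : 0 < c := Nat.cast_pos.2 hc
  set bad := (univ : Finset (α × β ≃ V)).filter (fun π =>
      x * c < ((nonLink E r D π).card : ℝ))
  have hb : 0 < (x - θ) * c := by positivity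
  have hlow : ∀ π ∈ bad, ((x - θ) * c) ^ s ≤ (seqCount (nonLink E r D π) s D : ℝ) := by
    intro π hπ
    have hπ' := (mem_filter.1 hπ).2
    refine pow_le_seqCount (F := nonLink E r D π) (r := r) (t := t) (D := D) hb.le
      (fun K hK => (mem_powersetCard.1 (mem_filter.1 hK).1).2) ?_ s D le_rfl ht
    intro T hDT hT
    have hsub : (nonLink E r D π).filter (fun K => ¬ Disjoint T K) ⊆
        powersetCard r (univ \ D) \ powersetCard r (univ \ T) := by
      intro K hK
      obtain ⟨hK1, hK2⟩ := mem_filter.1 hK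
      refine mem_sdiff.2 ⟨(mem_filter.1 hK1).1, fun h => hK2 ?_⟩
      exact (disjoint_sdiff (s := T) (t := univ)).mono_right (mem_powersetCard.1 h).1
    have h1 := card_le_card hsub
    have h2 := card_filter_add_card_filter_not (s := nonLink E r D π) (Disjoint T)
    rw [card_sdiff_of_subset (powersetCard_mono (sdiff_subset_sdiff le_rfl hDT)),
      card_powersetCard, card_powersetCard, card_sdiff_of_subset (subset_univ _),
      card_sdiff_of_subset (subset_univ _), card_univ] at h1
    have hle : (Fintype.card α - T.card).choose r ≤ (Fintype.card α - D.card).choose r :=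
      Nat.choose_le_choose _ (Nat.sub_le_sub_left (card_le_card hDT) _)
    have h3 : (nonLink E r D π).card + (Fintype.card α - T.card).choose r ≤
        ((nonLink E r D π).filter (Disjoint T)).card +
          (Fintype.card α - D.card).choose r := by omega
    have h4 : (Fintype.card α - t).choose r ≤ (Fintype.card α - T.card).choose r :=
      Nat.choose_le_choose _ (Nat.sub_le_sub_left hT _)
    have h3' : ((nonLink E r D π).card : ℝ) + ((Fintype.card α - T.card).choose r : ℝ) ≤
        (((nonLink E r D π).filter (Disjoint T)).card : ℝ) + c := by
      rw [hc_def]; exact_mod_cast h3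
    have h4' : ((Fintype.card α - t).choose r : ℝ) ≤
        ((Fintype.card α - T.card).choose r : ℝ) := by exact_mod_cast h4
    linarith
  have hup := sum_seqCount_nonLink_le E ha hB hpos haB s D le_rfl ht
    (univ : Finset (α × β ≃ V)) (fun _ _ _ _ => mem_univ _)
  rw [card_univ] at hup
  have hsum : (bad.card : ℝ) * ((x - θ) * c) ^ s ≤
      ∑ π : α × β ≃ V, (seqCount (nonLink E r D π) s D : ℝ) := by
    calc (bad.card : ℝ) * ((x - θ) * c) ^ s = ∑ _π ∈ bad, ((x - θ) * c) ^ s := by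
          rw [sum_const, nsmul_eq_mul]
      _ ≤ ∑ π ∈ bad, (seqCount (nonLink E r D π) s D : ℝ) := sum_le_sum hlow
      _ ≤ _ := sum_le_sum_of_subset_of_nonneg (subset_univ _) fun _ _ _ => Nat.cast_nonneg _
  refine le_of_mul_le_mul_right ?_ (pow_pos hb s)
  calc (bad.card : ℝ) * ((x - θ) * c) ^ s ≤ _ := hsum.trans hup
    _ ≤ (Fintype.card (α × β ≃ V) : ℝ) * (ρ * ((x - θ) * c)) ^ s := by
        gcongr _ * ?_ ^ s
        calc c * a ≤ c * (ρ * (x - θ)) := by gcongr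
          _ = _ := by ring
    _ = _ := by rw [mul_pow]; ring

lemma minDegGe_squash {k d q n : ℕ} (hdk : d ≤ k) {V : Type*} [DecidableEq V]
    (E : Finset (Finset V)) (π : Fin n × Fin q ≃ V) {x : ℝ}
    (h : ∀ D : Finset (Fin n), D.card = d →
      ((nonLink E (k - d) D π).card : ℝ) ≤ (1 - x) * ((n - d).choose (k - d) : ℝ)) :
    MinDegGe d (squash E k π) (x * ((n - d).choose (k - d) : ℝ)) := by
  intro D hD
  have hu : ∀ e ∈ squash E k π, e.card = k :=
    fun e he => (mem_powersetCard.1 (mem_filter.1 he).1).2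
  have h1 := card_filter_superset_add_card_nonedges hu D
  have h2 : (powersetCard (k - D.card) (univ \ D)).filter (fun R => D ∪ R ∉ squash E k π) =
      nonLink E (k - d) D π := by
    rw [nonLink, hD]
    refine filter_congr fun R hR => ?_
    obtain ⟨hR1, hR2⟩ := mem_powersetCard.1 hR
    have hdis : Disjoint D R := (disjoint_sdiff (s := D) (t := univ)).mono_right hR1
    have hc : (D ∪ R).card = k := by rw [card_union_of_disjoint hdis, hD, hR2]; omega
    simp [squash, mem_powersetCard, hc]
  rw [h2, hD, Fintype.card_fin] at h1
  have h1' : (((squash E k π).filter (fun e => D ⊆ e)).card : ℝ) +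
      ((nonLink E (k - d) D π).card : ℝ) = ((n - d).choose (k - d) : ℝ) := by exact_mod_cast h1
  have := h D hD
  linarith

/-- Growth estimates for `s = √n`. -/
lemma exists_sqrt_growth (C d : ℕ) {θ ρ : ℝ} (hθ : 0 < θ) (hρ0 : 0 < ρ) (hρ1 : ρ < 1) :
    ∃ n₀ : ℕ, ∀ n : ℕ, n₀ ≤ n →
      (C : ℝ) * (n.sqrt + 1) + θ * d ≤ θ * n ∧ (n : ℝ) ^ d * ρ ^ n.sqrt < 1 := by
  have hlim := (tendsto_pow_const_mul_const_pow_of_abs_lt_one (2 * d)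
    (r := ρ) (by rwa [abs_of_pos hρ0])).comp (Filter.tendsto_add_atTop_nat 1)
  have hev := hlim.eventually (gt_mem_nhds hρ0)
  obtain ⟨s₁, hs₁⟩ := Filter.eventually_atTop.1 hev
  obtain ⟨s₂, hs₂⟩ := exists_nat_ge ((2 * C + θ * d) / θ)
  refine ⟨(max s₁ (max s₂ 1)) ^ 2, fun n hn => ?_⟩
  have hs : max s₁ (max s₂ 1) ≤ n.sqrt := Nat.le_sqrt'.2 hn
  have hsq : n.sqrt ^ 2 ≤ n := Nat.sqrt_le' n
  have hlt : n < (n.sqrt + 1) ^ 2 := Nat.lt_succ_sqrt' n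
  set s := n.sqrt
  have hs1 : s₁ ≤ s := (le_max_left _ _).trans hs
  have hs2 : s₂ ≤ s := ((le_max_left _ _).trans (le_max_right _ _)).trans hs
  have hs3 : 1 ≤ s := ((le_max_right _ _).trans (le_max_right _ _)).trans hs
  have hs3' : (1 : ℝ) ≤ s := by exact_mod_cast hs3
  constructor
  · have h1 : 2 * C + θ * d ≤ s * θ := by
      rw [← div_le_iff₀ hθ]
      exact hs₂.trans (by exact_mod_cast hs2)
    have h2 : ((s : ℝ)) ^ 2 ≤ n := by exact_mod_cast hsq
    calc (C : ℝ) * (s + 1) + θ * d ≤ C * (s + s) + θ * d * s := by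
          exact add_le_add (by gcongr) (le_mul_of_one_le_right (by positivity) hs3')
      _ = (2 * C + θ * d) * s := by ring
      _ ≤ (s * θ) * s := by gcongr
      _ = θ * (s : ℝ) ^ 2 := by ring
      _ ≤ θ * n := by gcongr
  · have h1 := hs₁ s hs1
    simp only [Function.comp_apply] at h1
    have h2 : (n : ℝ) ^ d ≤ ((s + 1 : ℕ) : ℝ) ^ (2 * d) := by
      rw [pow_mul]
      gcongr
      exact_mod_cast hlt.le
    rw [pow_succ, ← mul_assoc] at h1
    have h3 : ((s + 1 : ℕ) : ℝ) ^ (2 * d) * ρ ^ s < 1 :=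
      lt_of_mul_lt_mul_right (by rwa [one_mul]) hρ0.le
    exact lt_of_le_of_lt (by gcongr) h3

/-- A union bound over the `d`-sets of groups. -/
lemma exists_forall_nonLink_le {α β V : Type*} [Fintype α] [DecidableEq α] [Fintype β]
    [DecidableEq β] [Fintype V] [DecidableEq V] (E : Finset (Finset V)) {d r : ℕ} {y η : ℝ}
    (hne : Nonempty (α × β ≃ V)) (hη : 0 ≤ η)
    (h : ∀ D : Finset α, D.card = d →
      (((univ : Finset (α × β ≃ V)).filter (fun π =>
        y < ((nonLink E r D π).card : ℝ))).card : ℝ) ≤ (Fintype.card (α × β ≃ V) : ℝ) * η)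
    (hη' : (Fintype.card α : ℝ) ^ d * η < 1) :
    ∃ π : α × β ≃ V, ∀ D : Finset α, D.card = d → ((nonLink E r D π).card : ℝ) ≤ y := by
  by_contra! hcon
  have hcover : (univ : Finset (α × β ≃ V)) ⊆ (powersetCard d (univ : Finset α)).biUnion
      (fun D => univ.filter (fun π => y < ((nonLink E r D π).card : ℝ))) := by
    intro π _
    obtain ⟨D, hD, hlt⟩ := hcon π
    exact mem_biUnion.2 ⟨D, mem_powersetCard.2 ⟨subset_univ _, hD⟩,
      mem_filter.2 ⟨mem_univ _, hlt⟩⟩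
  have h1 := (card_le_card hcover).trans card_biUnion_le
  rw [card_univ] at h1
  have hpos : (0 : ℝ) < Fintype.card (α × β ≃ V) := Nat.cast_pos.2 Fintype.card_pos
  have h2 : (Fintype.card (α × β ≃ V) : ℝ) ≤
      (Fintype.card α : ℝ) ^ d * ((Fintype.card (α × β ≃ V) : ℝ) * η) := by
    calc (Fintype.card (α × β ≃ V) : ℝ) ≤ ∑ D ∈ powersetCard d (univ : Finset α),
          (((univ : Finset (α × β ≃ V)).filter (fun π =>
            y < ((nonLink E r D π).card : ℝ))).card : ℝ) := by exact_mod_cast h1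
      _ ≤ ∑ _D ∈ powersetCard d (univ : Finset α), (Fintype.card (α × β ≃ V) : ℝ) * η :=
          sum_le_sum fun D hD => h D (mem_powersetCard.1 hD).2
      _ = ((Fintype.card α).choose d : ℝ) * ((Fintype.card (α × β ≃ V) : ℝ) * η) := by
          rw [sum_const, nsmul_eq_mul, card_powersetCard, card_univ]
      _ ≤ _ := by
          gcongr
          exact_mod_cast Nat.choose_le_pow _ _
  nlinarith

end Random

section Threshold

open Finset

/-- Every large `qk`-graph of `qd`-degree density at least `δ + ε` has an arrangement into groups
whose squashed `k`-graph has `d`-degree density at least `δ + ε / 2`. -/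
lemma exists_minDegGe_squash {k d q : ℕ} (hdk : d < k) (hq : 0 < q) {δ ε : ℝ} (hδ : 0 ≤ δ)
    (hε : 0 < ε) :
    ∃ n₀ : ℕ, ∀ n : ℕ, n₀ ≤ n → ∀ E : Finset (Finset (Fin (q * n))),
      (∀ e ∈ E, e.card = q * k) →
      MinDegGe (q * d) E ((δ + ε) * ((q * n - q * d).choose (q * k - q * d) : ℝ)) →
      ∃ π : Fin n × Fin q ≃ Fin (q * n),
        MinDegGe d (squash E k π) ((δ + ε / 2) * ((n - d).choose (k - d) : ℝ)) := by
  obtain ⟨r, rfl⟩ : ∃ r, k = d + r := ⟨k - d, by omega⟩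
  have hr : 1 ≤ r := by omega
  set ρ : ℝ := (1 + ε / 4) / (1 + 3 * ε / 8) with hρ
  have hρ0 : 0 < ρ := by positivity
  have hρ1 : ρ < 1 := by rw [hρ, div_lt_one (by positivity)]; linarith
  obtain ⟨n₁, hn₁⟩ := exists_sqrt_growth (q * r ^ 2) d (θ := ε / 8) (by positivity) hρ0 hρ1
  obtain ⟨n₂, hn₂⟩ := exists_sqrt_growth r d (θ := 1) one_pos hρ0 hρ1
  refine ⟨max n₁ n₂, fun n hn E hE hdeg => ?_⟩
  obtain ⟨hgrow, hunion⟩ := hn₁ n ((le_max_left _ _).trans hn)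
  have hgrow' := (hn₂ n ((le_max_right _ _).trans hn)).1
  set s := n.sqrt
  have hn_large : d + s * r + r ≤ n := by
    have : ((d + s * r + r : ℕ) : ℝ) ≤ n := by push_cast; linarith
    exact_mod_cast this
  have hsub : q * n - q * d = (n - d) * q := by rw [← Nat.mul_sub, mul_comm]
  have hsub' : q * (d + r) - q * d = r * q := by
    rw [← Nat.mul_sub, Nat.add_sub_cancel_left, mul_comm]
  rw [hsub, hsub'] at hdeg
  rw [Nat.add_sub_cancel_left]
  set c : ℝ := (((n - d) * q).choose (r * q) : ℝ) with hc
  have hcpos : 0 < c := Nat.cast_pos.2 (Nat.choose_pos (Nat.mul_le_mul_right q (by omega)))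
  have hnonedges : ∀ S : Finset (Fin (q * n)), S.card = q * d →
      (((powersetCard (r * q) (univ \ S)).filter (fun R => S ∪ R ∉ E)).card : ℝ) ≤
        (1 - (δ + ε)) * c := by
    intro S hS
    have h1 := card_filter_superset_add_card_nonedges hE S
    rw [hS, Fintype.card_fin, hsub, hsub'] at h1
    have h1' : ((E.filter (fun e => S ⊆ e)).card : ℝ) +
        (((powersetCard (r * q) (univ \ S)).filter (fun R => S ∪ R ∉ E)).card : ℝ) = c := by
      rw [hc]; exact_mod_cast h1
    have := hdeg S hS
    linarith
  obtain ⟨S, -, hS⟩ := exists_subset_card_eq (s := (univ : Finset (Fin (q * n)))) (n := q * d)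
    (by rw [card_univ, Fintype.card_fin]; exact Nat.mul_le_mul_left q (by omega))
  have hy0 : 0 ≤ 1 - (δ + ε) :=
    nonneg_of_mul_nonneg_left ((Nat.cast_nonneg _).trans (hnonedges S hS)) hcpos
  have hε1 : ε ≤ 1 := by linarith
  set t := d + s * r with ht
  have hnd : ((n - d : ℕ) : ℝ) = n - d := by rw [Nat.cast_sub (by omega)]
  have hmain : (q : ℝ) * r ^ 2 * s ≤ ε / 8 * ((n - d : ℕ) : ℝ) := by
    rw [hnd]
    push_cast at hgrow
    nlinarith [show (0 : ℝ) ≤ q * r ^ 2 by positivity]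
  have hgroups : (1 - ε / 8) * ((n - d).choose r : ℝ) ≤ ((n - t).choose r : ℝ) := by
    have h := one_sub_mul_choose_le (M := n - d) (t := s * r) (θ := ε / 8) hr (by omega)
      (by omega) (by
        refine le_trans ?_ hmain
        have hq1 : (1 : ℝ) ≤ q := by exact_mod_cast hq
        push_cast
        calc (r : ℝ) * (s * r) = 1 * (r ^ 2 * s) := by ring
          _ ≤ q * (r ^ 2 * s) := by gcongr
          _ = _ := by ring)
    rwa [Nat.sub_sub] at h
  have hverts : (1 - ε / 8) * c ≤ (((n - t) * q).choose (r * q) : ℝ) := by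
    have h := one_sub_mul_choose_le (M := (n - d) * q) (t := s * r * q) (r := r * q)
      (θ := ε / 8) (Nat.mul_pos hr hq) (Nat.mul_pos (by omega) hq)
      (Nat.mul_le_mul_right q (by omega)) (by
        have h := mul_le_mul_of_nonneg_right hmain (Nat.cast_nonneg (α := ℝ) q)
        push_cast at h ⊢
        linarith)
    rwa [← Nat.sub_mul, Nat.sub_sub] at h
  have hθ1 : 0 < 1 - ε / 8 := by linarith
  have hne : Nonempty (Fin n × Fin q ≃ Fin (q * n)) :=
    Fintype.card_eq.1 (by simp [mul_comm])
  obtain ⟨π, hπ⟩ := exists_forall_nonLink_le E (d := d) (r := r)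
    (y := (1 - (δ + ε / 2)) * ((n - d).choose r : ℝ)) (η := ρ ^ s) hne (by positivity)
    (fun D hD => by
      have h := card_filter_lt_nonLink_le (α := Fin n) (β := Fin q) E (D := D) (r := r) (s := s)
        (t := t) (B := ⌊(1 - (δ + ε)) * c⌋₊) (a := (1 - (δ + ε)) / (1 - ε / 8))
        (x := 1 - (δ + ε / 2)) (θ := ε / 8) (ρ := ρ) (by positivity)
      simp only [Fintype.card_fin, hD] at h
      refine h ?_ ?_ ?_ le_rfl (Nat.choose_pos (by omega)) hgroups (by linarith) ?_
      · intro S hS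
        exact Nat.le_floor (hnonedges S (by rw [hS, mul_comm]))
      · exact Nat.choose_pos (Nat.mul_le_mul_right q (by omega))
      · refine (Nat.floor_le (by positivity)).trans ?_
        calc (1 - (δ + ε)) * c = (1 - (δ + ε)) / (1 - ε / 8) * ((1 - ε / 8) * c) := by
              rw [← mul_assoc, div_mul_cancel₀ _ hθ1.ne']
          _ ≤ _ := by gcongr
      · rw [hρ, div_mul_eq_mul_div, div_le_div_iff₀ hθ1 (by positivity)]
        obtain ⟨y, hy⟩ : ∃ y, y = 1 - (δ + ε) := ⟨_, rfl⟩
        have hx : 1 - (δ + ε / 2) - ε / 8 = y + 3 * ε / 8 := by rw [hy]; ring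
        rw [hx, ← hy]
        have hy0' : 0 ≤ y := hy ▸ hy0
        have hy1 : y ≤ 1 := by linarith
        have h1 : y * (1 + 3 * ε / 8) ≤ y + 3 * ε / 8 := by nlinarith
        have h2 : 1 ≤ (1 + ε / 4) * (1 - ε / 8) := by nlinarith
        calc y * (1 + 3 * ε / 8) ≤ y + 3 * ε / 8 := h1
          _ ≤ (y + 3 * ε / 8) * ((1 + ε / 4) * (1 - ε / 8)) :=
              le_mul_of_one_le_right (by positivity) h2
          _ = _ := by ring)
    (by rwa [Fintype.card_fin])
  refine ⟨π, ?_⟩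
  have := minDegGe_squash (k := d + r) (Nat.le_add_right d r) E π (x := δ + ε / 2) (by
    rwa [Nat.add_sub_cancel_left])
  rwa [Nat.add_sub_cancel_left] at this

lemma HamMinDegProp.squash {k ℓ d q : ℕ} (hdk : d < k) (hℓk : ℓ < k) (hq : 0 < q) {δ : ℝ}
    (hδ : 0 ≤ δ) (h : HamMinDegProp k ℓ d δ) : HamMinDegProp (q * k) (q * ℓ) (q * d) δ := by
  intro ε hε
  obtain ⟨n₁, hn₁⟩ := exists_minDegGe_squash hdk hq hδ hε
  obtain ⟨n₂, hn₂⟩ := h (ε / 2) (half_pos hε)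
  refine ⟨q * max n₁ n₂, fun N hN hdvd E hE hdeg => ?_⟩
  rw [← Nat.mul_sub] at hdvd
  obtain ⟨n, rfl⟩ := (Dvd.intro _ rfl).trans hdvd
  have hn := Nat.le_of_mul_le_mul_left hN hq
  obtain ⟨π, hπ⟩ := hn₁ n ((le_max_left _ _).trans hn) E hE hdeg
  exact HamiltonLCycle.of_squash hℓk hq π
    (hn₂ n ((le_max_right _ _).trans hn) (Nat.dvd_of_mul_dvd_mul_left hq hdvd) _
      (fun e he => (mem_powersetCard.1 (mem_filter.1 he).1).2) hπ)

/-- The density `1` is always sufficient, since no larger minimum degree is possible. -/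
lemma hamMinDegProp_one {k ℓ d : ℕ} (hdk : d ≤ k) : HamMinDegProp k ℓ d 1 := by
  refine fun ε hε => ⟨k, fun n hn _ E hE hdeg => ?_⟩
  obtain ⟨S, -, hS⟩ := exists_subset_card_eq (s := (univ : Finset (Fin n))) (n := d)
    (by rw [card_univ, Fintype.card_fin]; omega)
  have h1 := card_filter_superset_add_card_nonedges hE S
  rw [hS, Fintype.card_fin] at h1
  have h2 : ((E.filter (fun e => S ⊆ e)).card : ℝ) ≤ ((n - d).choose (k - d) : ℝ) :=
    Nat.cast_le.2 (by omega)
  have hpos : (0 : ℝ) < ((n - d).choose (k - d) : ℝ) :=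
    Nat.cast_pos.2 (Nat.choose_pos (by omega))
  have h3 := hdeg S hS
  nlinarith [mul_pos hε hpos]

end Threshold

/-- **Theorem (squashing).** For `1 ≤ d ≤ k - 1`, `1 ≤ ℓ ≤ k - 1` and `q ≥ 2`, we have
`δ_{qd}^{ham}(qk, qℓ) ≤ δ_d^{ham}(k, ℓ)`. -/
theorem hamThreshold_squash (k ℓ d q : ℕ) (hd1 : 1 ≤ d) (hd2 : d ≤ k - 1)
    (hℓ1 : 1 ≤ ℓ) (hℓ2 : ℓ ≤ k - 1) (hq : 2 ≤ q) :
    hamThreshold (q * k) (q * ℓ) (q * d) ≤ hamThreshold k ℓ d := by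
  exact csInf_le_csInf ⟨0, fun _ h => h.1⟩ ⟨1, zero_le_one, le_rfl, hamMinDegProp_one (by omega)⟩
    fun _ h => ⟨h.1, h.2.1, h.2.2.squash (by omega) (by omega) (by omega) h.1⟩
end

section
/- For every k ≥ 3 and ε > 0 there exists n₀ such that every k-graph G on n ≥ n₀ vertices with minimum (k−2)-degree δ_{k−2}(G) ≥ (1/4 + ε)·C(n,2) is (k−2)-connected, i.e., all edges of G lie in a single (k−2)-component and G has no isolated vertices. -/
/-- A hypergraph on a finite set of natural numbers. -/
structure HG where
  verts : Finset ℕ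
  edges : Finset (Finset ℕ)

/-- `H` is a `k`-uniform hypergraph (a `k`-graph). -/
def HG.IsUniform (k : ℕ) (H : HG) : Prop := ∀ e ∈ H.edges, e ⊆ H.verts ∧ e.card = k

/-- Delete a vertex from a hypergraph (removing all edges through it). -/
def HG.delete (H : HG) (x : ℕ) : HG :=
  ⟨H.verts.erase x, H.edges.filter (fun e => x ∉ e)⟩

/-- Union of two hypergraphs. -/
def HG.union (A B : HG) : HG := ⟨A.verts ∪ B.verts, A.edges ∪ B.edges⟩

/-- `H` is `ℓ`-connected: it has no isolated vertices and any two of its edges are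
joined by a walk of edges of `H` in which consecutive edges share at least `ℓ`
vertices (i.e. its edges induce a connected subgraph of the `ℓ`-line graph). -/
def LConn (ℓ : ℕ) (H : HG) : Prop :=
  (∀ v ∈ H.verts, ∃ e ∈ H.edges, v ∈ e) ∧
  ∀ e ∈ H.edges, ∀ f ∈ H.edges,
    Relation.ReflTransGen (fun a b => a ∈ H.edges ∧ b ∈ H.edges ∧ ℓ ≤ (a ∩ b).card) e f

/-- `FE` is the edge set of an `ℓ`-component of the hypergraph with edge set `GE`:
a nonempty set of edges which is connected in the `ℓ`-line graph and closed under
`ℓ`-adjacency (equivalently, edge-maximal `ℓ`-connected). -/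
def IsLComponentEdges (ℓ : ℕ) (GE FE : Finset (Finset ℕ)) : Prop :=
  FE ⊆ GE ∧ FE.Nonempty ∧
  (∀ e ∈ FE, ∀ f ∈ FE,
    Relation.ReflTransGen (fun a b => a ∈ FE ∧ b ∈ FE ∧ ℓ ≤ (a ∩ b).card) e f) ∧
  (∀ e ∈ FE, ∀ f ∈ GE, ℓ ≤ (e ∩ f).card → f ∈ FE)

/-- The hypergraph `H` has minimum `d`-degree at least `x`. -/
def HG.MinDegGe (H : HG) (d : ℕ) (x : ℝ) : Prop :=
  ∀ S : Finset ℕ, S ⊆ H.verts → S.card = d →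
    x ≤ ((H.edges.filter (fun e => S ⊆ e)).card : ℝ)

/-- The relation on edges of lying in a common `ℓ`-component. -/
def HG.Reach (ℓ : ℕ) (G : HG) : Finset ℕ → Finset ℕ → Prop :=
  Relation.ReflTransGen (fun a b => a ∈ G.edges ∧ b ∈ G.edges ∧ ℓ ≤ (a ∩ b).card)

theorem HG.Reach.symm {ℓ : ℕ} {G : HG} {e f : Finset ℕ} (h : G.Reach ℓ e f) :
    G.Reach ℓ f e := by
  induction h with
  | refl => exact Relation.ReflTransGen.refl
  | tail _ hbc ih =>
    exact Relation.ReflTransGen.head ⟨hbc.2.1, hbc.1, by rw [Finset.inter_comm]; exact hbc.2.2⟩ ih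

theorem HG.reach_of_common_subset {ℓ : ℕ} {G : HG} {e f S : Finset ℕ} (he : e ∈ G.edges)
    (hf : f ∈ G.edges) (hSe : S ⊆ e) (hSf : S ⊆ f) (hS : ℓ ≤ S.card) : G.Reach ℓ e f :=
  Relation.ReflTransGen.single
    ⟨he, hf, hS.trans (Finset.card_le_card (Finset.subset_inter hSe hSf))⟩

theorem lt_two_mul_of_quarter_choose_two_le {ε : ℝ} (hε : 0 < ε) {n a : ℕ} (hn : 2 ≤ n)
    (h : (1 / 4 + ε) * ((n.choose 2 : ℕ) : ℝ) ≤ ((a.choose 2 : ℕ) : ℝ)) : n < 2 * a := by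
  by_contra! hle
  have hn' : (2 : ℝ) ≤ n := by exact_mod_cast hn
  have hle' : (2 : ℝ) * a ≤ n := by exact_mod_cast hle
  have ha : (0 : ℝ) ≤ a := Nat.cast_nonneg a
  rw [Nat.cast_choose_two, Nat.cast_choose_two] at h
  have h₁ : 0 < ε * ((n : ℝ) * (n - 1) / 2) := by
    have : (0 : ℝ) < n - 1 := by linarith
    positivity
  have h₂ : 0 ≤ ((n : ℝ) - 2 * a) * (n + 2 * a - 1) :=
    mul_nonneg (by linarith) (by linarith)
  nlinarith

/-- The vertices outside `T` that form, together with `T`, part of an edge reachable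
from `e`. -/
noncomputable def HG.reachSet (ℓ : ℕ) (G : HG) (T e : Finset ℕ) : Finset ℕ := by
  classical
  exact G.verts.filter (fun v => v ∉ T ∧ ∃ g ∈ G.edges, insert v T ⊆ g ∧ G.Reach ℓ e g)

theorem HG.mem_reachSet {ℓ : ℕ} {G : HG} {T e : Finset ℕ} {v : ℕ} :
    v ∈ G.reachSet ℓ T e ↔
      v ∈ G.verts ∧ v ∉ T ∧ ∃ g ∈ G.edges, insert v T ⊆ g ∧ G.Reach ℓ e g := by
  simp [HG.reachSet]

theorem HG.card_verts_lt_two_mul_card_reachSet {ℓ : ℕ} {ε : ℝ} (hε : 0 < ε) {G : HG}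
    (hG : G.IsUniform (ℓ + 2)) (hn : 2 ≤ G.verts.card)
    (hdeg : G.MinDegGe ℓ ((1 / 4 + ε) * ((G.verts.card.choose 2 : ℕ) : ℝ)))
    {T e : Finset ℕ} (hT : T.card + 1 = ℓ) (he : e ∈ G.edges) (hTe : T ⊆ e) :
    G.verts.card < 2 * (G.reachSet ℓ T e).card := by
  obtain ⟨v, hve, hvT⟩ := Finset.exists_mem_notMem_of_card_lt_card
    (show T.card < e.card by have := (hG e he).2; omega)
  have hS : (insert v T).card = ℓ := by rw [Finset.card_insert_of_notMem hvT, hT]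
  have hSe : insert v T ⊆ e := Finset.insert_subset hve hTe
  refine lt_two_mul_of_quarter_choose_two_le hε hn
    ((hdeg (insert v T) (hSe.trans (hG e he).1) hS).trans ?_)
  rw [← Finset.card_powersetCard]
  norm_cast
  refine Finset.card_le_card_of_injOn (fun g => g \ insert v T) ?_ ?_
  · intro g hg
    obtain ⟨hgE, hSg⟩ := Finset.mem_filter.mp hg
    refine Finset.mem_coe.mpr (Finset.mem_powersetCard.mpr ⟨fun u hu => ?_, ?_⟩)
    · obtain ⟨hug, huS⟩ := Finset.mem_sdiff.mp hu
      exact HG.mem_reachSet.mpr ⟨(hG g hgE).1 hug, fun h => huS (Finset.mem_insert_of_mem h),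
        g, hgE, Finset.insert_subset hug ((Finset.subset_insert v T).trans hSg),
        HG.reach_of_common_subset he hgE hSe hSg hS.ge⟩
    · have := (hG g hgE).2
      rw [Finset.card_sdiff_of_subset hSg]
      omega
  · intro g hg g' hg' h
    have h₁ := (Finset.mem_filter.mp hg).2
    have h₂ := (Finset.mem_filter.mp hg').2
    rw [← Finset.sdiff_union_of_subset h₁, ← Finset.sdiff_union_of_subset h₂]
    exact congrArg (· ∪ insert v T) h

theorem HG.reach_of_common_subset_pred {ℓ : ℕ} {ε : ℝ} (hε : 0 < ε) {G : HG}
    (hG : G.IsUniform (ℓ + 2)) (hn : 2 ≤ G.verts.card)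
    (hdeg : G.MinDegGe ℓ ((1 / 4 + ε) * ((G.verts.card.choose 2 : ℕ) : ℝ)))
    {T e f : Finset ℕ} (hT : T.card + 1 = ℓ) (he : e ∈ G.edges) (hf : f ∈ G.edges)
    (hTe : T ⊆ e) (hTf : T ⊆ f) : G.Reach ℓ e f := by
  have hAe := HG.card_verts_lt_two_mul_card_reachSet hε hG hn hdeg hT he hTe
  have hAf := HG.card_verts_lt_two_mul_card_reachSet hε hG hn hdeg hT hf hTf
  have hsub : ∀ e, G.reachSet ℓ T e ⊆ G.verts := fun e v hv => (HG.mem_reachSet.mp hv).1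
  obtain ⟨v, hv⟩ := Finset.inter_nonempty_of_card_lt_card_add_card (hsub e) (hsub f)
    (by omega)
  obtain ⟨hve, hvf⟩ := Finset.mem_inter.mp hv
  obtain ⟨-, hvT, g, hg, hgT, heg⟩ := HG.mem_reachSet.mp hve
  obtain ⟨-, -, g', hg', hgT', hfg⟩ := HG.mem_reachSet.mp hvf
  have hgg : G.Reach ℓ g g' := HG.reach_of_common_subset hg hg' hgT hgT'
    (by rw [Finset.card_insert_of_notMem hvT, hT])
  exact (heg.trans hgg).trans hfg.symm

theorem HG.MinDegGe.exists_edge_superset {d : ℕ} {x : ℝ} (hx : 0 < x) {G : HG}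
    (hdeg : G.MinDegGe d x) (hd : d ≤ G.verts.card) {S : Finset ℕ} (hS : S ⊆ G.verts)
    (hSd : S.card ≤ d) : ∃ e ∈ G.edges, S ⊆ e := by
  obtain ⟨U, hSU, hUV, hU⟩ := Finset.exists_subsuperset_card_eq hS hSd hd
  have hpos : 0 < (G.edges.filter (fun e => U ⊆ e)).card := by
    exact_mod_cast hx.trans_le (hdeg U hUV hU)
  obtain ⟨e, he⟩ := Finset.card_pos.mp hpos
  obtain ⟨heE, hUe⟩ := Finset.mem_filter.mp he
  exact ⟨e, heE, hSU.trans hUe⟩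

theorem HG.reach_of_superset_of_card_add {ℓ : ℕ} {ε : ℝ} (hε : 0 < ε) {G : HG}
    (hG : G.IsUniform (ℓ + 2)) (hn : 2 ≤ G.verts.card) (hℓ : ℓ ≤ G.verts.card)
    (hdeg : G.MinDegGe ℓ ((1 / 4 + ε) * ((G.verts.card.choose 2 : ℕ) : ℝ)))
    (d : ℕ) {T e f : Finset ℕ} (hT : T.card + 1 + d = ℓ) (he : e ∈ G.edges)
    (hf : f ∈ G.edges) (hTe : T ⊆ e) (hTf : T ⊆ f) : G.Reach ℓ e f := by
  induction d generalizing T e f with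
  | zero => exact HG.reach_of_common_subset_pred hε hG hn hdeg hT he hf hTe hTf
  | succ d ih =>
    obtain ⟨heV, hek⟩ := hG e he
    obtain ⟨hfV, hfk⟩ := hG f hf
    obtain ⟨x, hxe, hxT⟩ := Finset.exists_mem_notMem_of_card_lt_card
      (show T.card < e.card by omega)
    obtain ⟨y, hyf, hyT⟩ := Finset.exists_mem_notMem_of_card_lt_card
      (show T.card < f.card by omega)
    have hxc := Finset.card_insert_of_notMem hxT
    have hyc := Finset.card_insert_of_notMem hyT
    have hpos : 0 < (1 / 4 + ε) * ((G.verts.card.choose 2 : ℕ) : ℝ) := by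
      have := Nat.choose_pos hn
      positivity
    obtain ⟨g, hg, hSg⟩ := hdeg.exists_edge_superset hpos hℓ
      (S := insert x (insert y T))
      (Finset.insert_subset (heV hxe) (Finset.insert_subset (hfV hyf) (hTe.trans heV)))
      (by have := Finset.card_insert_le x (insert y T); omega)
    have hyg : insert y T ⊆ g := (Finset.subset_insert _ _).trans hSg
    have hxg : insert x T ⊆ g :=
      (Finset.insert_subset_insert x (Finset.subset_insert y T)).trans hSg
    exact (ih (T := insert x T) (by omega) he hg (Finset.insert_subset hxe hTe) hxg).trans
      (ih (T := insert y T) (by omega) hg hf hyg (Finset.insert_subset hyf hTf))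

/-- **Lemma.** For `k ≥ 3` and `ε > 0`, every sufficiently large `k`-graph `G` on `n`
vertices with minimum `(k-2)`-degree at least `(1/4 + ε)·C(n,2)` is
`(k-2)`-connected. -/
theorem lconn_of_quarter_minDeg (k : ℕ) (hk : 3 ≤ k) (ε : ℝ) (hε : 0 < ε) :
    ∃ n₀ : ℕ, ∀ G : HG, G.IsUniform k → n₀ ≤ G.verts.card →
      G.MinDegGe (k - 2) ((1 / 4 + ε) * ((G.verts.card.choose 2 : ℕ) : ℝ)) →
      LConn (k - 2) G := by
  refine ⟨k, fun G hG hn hdeg => ?_⟩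
  obtain ⟨ℓ, rfl⟩ : ∃ ℓ, k = ℓ + 2 := ⟨k - 2, by omega⟩
  rw [Nat.add_sub_cancel] at hdeg ⊢
  have hn₂ : 2 ≤ G.verts.card := by omega
  have hpos : 0 < (1 / 4 + ε) * ((G.verts.card.choose 2 : ℕ) : ℝ) := by
    have := Nat.choose_pos hn₂
    positivity
  refine ⟨fun v hv => ?_, fun e he f hf => ?_⟩
  · obtain ⟨e, he, hve⟩ := hdeg.exists_edge_superset hpos (by omega)
      (Finset.singleton_subset_iff.mpr hv) (by rw [Finset.card_singleton]; omega)
    exact ⟨e, he, Finset.singleton_subset_iff.mp hve⟩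
  · exact HG.reach_of_superset_of_card_add hε hG hn₂ (by omega) hdeg (ℓ - 1) (T := ∅)
      (by rw [Finset.card_empty]; omega) he hf (Finset.empty_subset e) (Finset.empty_subset f)
end

section
/- Let 1 ≤ ℓ ≤ k−1 with k−ℓ not dividing k, and let ε > 0. Then there exists t₀ such that for every t ≥ t₀ there is a k-partite k-uniform ℓ-cycle on m = t·(k−ℓ) vertices with parts of sizes α₁m, …, α_km, where |α₁ − λ(k,ℓ)| ≤ ε and |α_i − (1 − λ(k,ℓ))/(k−1)| ≤ ε for every 2 ≤ i ≤ k. -/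
theorem exists_add_mul_mod_eq {n r : ℕ} (h0 : 0 < r) (hr : r < n + 1) (hnd : ¬ r ∣ n + 1)
    {x : ℕ} (hx : x < n + 1) :
    ∃ i a, i ≤ n ∧ a + 1 < r ∧ (a + i * r) % (n + 1) = x := by
  have hd : Nat.gcd r (n + 1) < r := lt_of_le_of_ne (Nat.gcd_le_left _ h0)
    (fun h => hnd (h ▸ Nat.gcd_dvd_right r (n + 1)))
  have hdp : 0 < Nat.gcd r (n + 1) := Nat.gcd_pos_of_pos_left _ h0
  obtain ⟨m, -, hm⟩ := Nat.exists_mul_mod_eq_gcd (hd.trans hr)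
  refine ⟨m * (x / r.gcd (n + 1)) % (n + 1), x % r.gcd (n + 1),
    Nat.lt_succ_iff.1 (Nat.mod_lt _ n.succ_pos), by have := Nat.mod_lt x hdp; omega, ?_⟩
  generalize r.gcd (n + 1) = d at *
  have h1 : (x % d + m * (x / d) % (n + 1) * r) ≡ x [MOD n + 1] := by
    calc x % d + m * (x / d) % (n + 1) * r ≡ x % d + m * (x / d) * r [MOD n + 1] :=
          ((Nat.mod_modEq _ _).mul_right _).add_left _
      _ = x % d + (r * m) * (x / d) := by ring
      _ ≡ x % d + d * (x / d) [MOD n + 1] := by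
          refine Nat.ModEq.add_left _ (Nat.ModEq.mul_right _ ?_)
          rw [← hm]; exact (Nat.mod_modEq _ _).symm
      _ = x := Nat.mod_add_div _ _
  rw [h1, Nat.mod_eq_of_lt hx]

/-- The permutations of positions that slide a window by `r`: position `j` is sent to `j + r`
whenever that is still a position, and the last `r` positions are filled arbitrarily. -/
def slides (k r : ℕ) : Set (Equiv.Perm (Fin k)) :=
  {h | ∀ j j' : Fin k, (j' : ℕ) = j + r → h j = j'}

theorem addRight_pow_apply_val {n : ℕ} (c : Fin (n + 1)) (i : ℕ) (a : Fin (n + 1)) :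
    (((Equiv.addRight c : Equiv.Perm (Fin (n + 1))) ^ i) a : ℕ) = (a + i * c) % (n + 1) := by
  induction i with
  | zero => simp [Nat.mod_eq_of_lt a.2]
  | succ i ih =>
    rw [pow_succ', Equiv.Perm.mul_apply, Equiv.coe_addRight, Fin.val_add, ih, Nat.mod_add_mod]
    congr 1; ring

theorem addRight_mem_slides {n r : ℕ} (hr : r < n + 1) :
    (Equiv.addRight (⟨r, hr⟩ : Fin (n + 1)) : Equiv.Perm (Fin (n + 1))) ∈ slides (n + 1) r := by
  intro j j' hj
  ext
  rw [Equiv.coe_addRight, Fin.val_add, hj]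
  exact Nat.mod_eq_of_lt (hj ▸ j'.2)

theorem addRight_pow_eq_one {n : ℕ} (c : Fin (n + 1)) :
    (Equiv.addRight c : Equiv.Perm (Fin (n + 1))) ^ (n + 1) = 1 := by
  ext a
  rw [addRight_pow_apply_val]
  simp [Nat.mod_eq_of_lt a.2]

theorem swap_mul_mem_slides {n r : ℕ} {a b : Fin n} (ha : (a : ℕ) < r) (hb : (b : ℕ) < r)
    {h : Equiv.Perm (Fin n)} (hh : h ∈ slides n r) : Equiv.swap a b * h ∈ slides n r := by
  intro j j' hj
  rw [Equiv.Perm.mul_apply, hh j j' hj, Equiv.swap_apply_of_ne_of_ne]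
  · rintro rfl; omega
  · rintro rfl; omega

open Pointwise in
theorem adjacent_swap_mem_slides_pow {n r : ℕ} (h0 : 0 < r) (hr : r < n + 1)
    (hnd : ¬ r ∣ n + 1) (x : Fin n) :
    Equiv.swap x.castSucc x.succ ∈ slides (n + 1) r ^ (n + 1) := by
  obtain ⟨i, a, hi, ha, hx⟩ := exists_add_mul_mod_eq h0 hr hnd (x := x) (by omega)
  set σ : Equiv.Perm (Fin (n + 1)) := Equiv.addRight (⟨r, hr⟩ : Fin (n + 1)) with hσ
  have hmem := addRight_mem_slides hr
  have h1 : x.castSucc = (σ ^ i) ⟨a, by omega⟩ := by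
    ext; rw [hσ, addRight_pow_apply_val]; exact hx.symm
  have h2 : x.succ = (σ ^ i) ⟨a + 1, by omega⟩ := by
    ext
    rw [hσ, addRight_pow_apply_val]
    change (x : ℕ) + 1 = (a + 1 + i * r) % (n + 1)
    rw [add_right_comm, Nat.add_mod, hx, Nat.add_mod_mod]
    exact (Nat.mod_eq_of_lt (by omega)).symm
  have h3 : (σ ^ i)⁻¹ = σ * σ ^ (n - i) := by
    rw [inv_eq_iff_mul_eq_one, ← pow_succ', ← pow_add,
      show i + (n - i + 1) = n + 1 by omega]
    exact addRight_pow_eq_one _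
  have h4 : slides (n + 1) r ^ (n + 1) =
      slides (n + 1) r ^ i * slides (n + 1) r * slides (n + 1) r ^ (n - i) := by
    rw [← pow_succ, ← pow_add]
    congr 1; omega
  rw [h1, h2, Equiv.swap_apply_apply, h3, ← mul_assoc, mul_assoc (σ ^ i), h4]
  exact Set.mul_mem_mul (Set.mul_mem_mul (Set.pow_mem_pow hmem)
    (swap_mul_mem_slides (by simp; omega) ha hmem)) (Set.pow_mem_pow hmem)

open Pointwise in
theorem exists_slides_pow_eq_univ {n r : ℕ} (h0 : 0 < r) (hr : r < n + 1) (hnd : ¬ r ∣ n + 1) :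
    ∃ N, slides (n + 1) r ^ N = Set.univ := by
  have hone : (1 : Equiv.Perm (Fin (n + 1))) ∈ slides (n + 1) r ^ (n + 1) :=
    addRight_pow_eq_one (⟨r, hr⟩ : Fin (n + 1)) ▸ Set.pow_mem_pow (addRight_mem_slides hr)
  have hall : ∀ g : Equiv.Perm (Fin (n + 1)), ∃ N, g ∈ (slides (n + 1) r ^ (n + 1)) ^ N := by
    intro g
    have hg : g ∈ Submonoid.closure
        (Set.range fun i : Fin n => Equiv.swap i.castSucc i.succ) := by
      rw [Equiv.Perm.mclosure_swap_castSucc_succ]; trivial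
    induction hg using Submonoid.closure_induction with
    | mem g hg =>
      obtain ⟨x, rfl⟩ := hg
      exact ⟨1, by rw [pow_one]; exact adjacent_swap_mem_slides_pow h0 hr hnd x⟩
    | one => exact ⟨0, by simp⟩
    | mul g g' _ _ h h' =>
      obtain ⟨N, h⟩ := h
      obtain ⟨N', h'⟩ := h'
      exact ⟨N + N', by rw [pow_add]; exact Set.mul_mem_mul h h'⟩
  choose N hN using hall
  refine ⟨(n + 1) * Finset.univ.sup N, Set.eq_univ_of_forall fun g => ?_⟩
  rw [pow_mul]
  exact Set.pow_subset_pow_right hone (Finset.le_sup (Finset.mem_univ g)) (hN g)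

open Pointwise in
theorem exists_walk_of_mem_pow {G : Type*} [Monoid G] {S : Set G} {b : ℕ} {g : G}
    (hg : g ∈ S ^ b) :
    ∃ w : ℕ → G, w 0 = 1 ∧ w b = g ∧ ∀ i < b, ∃ h ∈ S, w (i + 1) = w i * h := by
  induction b generalizing g with
  | zero => exact ⟨fun _ => 1, rfl, by simpa using hg.symm, by simp⟩
  | succ b ih =>
    rw [pow_succ] at hg
    obtain ⟨g', hg', h, hh, rfl⟩ := Set.mem_mul.1 hg
    obtain ⟨w, hw0, hwb, hw⟩ := ih hg'
    refine ⟨fun i => if i ≤ b then w i else g' * h, by simpa using hw0, by simp, fun i hi => ?_⟩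
    rcases Nat.lt_succ_iff_lt_or_eq.1 hi with hi | rfl
    · simpa [hi.le, Nat.succ_le_of_lt hi] using hw i hi
    · exact ⟨h, hh, by simp [hwb]⟩

/-- Any two windows are joined by a walk of a fixed length, each step sliding by `r`. -/
theorem exists_connecting_length {k r : ℕ} (h0 : 0 < r) (hr : r < k) (hnd : ¬ r ∣ k) :
    ∃ L, ∀ u v : Equiv.Perm (Fin k), ∃ w : ℕ → Equiv.Perm (Fin k), w 0 = u ∧ w L = v ∧
      ∀ i < L, ∀ j j' : Fin k, (j' : ℕ) = j + r → w (i + 1) j = w i j' := by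
  obtain ⟨n, rfl⟩ := Nat.exists_eq_succ_of_ne_zero (by omega : k ≠ 0)
  obtain ⟨L, hL⟩ := exists_slides_pow_eq_univ h0 hr hnd
  refine ⟨L, fun u v => ?_⟩
  obtain ⟨w, hw0, hwL, hw⟩ := exists_walk_of_mem_pow (hL ▸ Set.mem_univ (u⁻¹ * v))
  refine ⟨fun i => u * w i, by simp [hw0], by simp [hwL], fun i hi j j' hj => ?_⟩
  obtain ⟨h, hh, hi⟩ := hw i hi
  simp only [hi, Equiv.Perm.mul_apply, hh j j' hj]

/-- The colouring of `ℕ` giving colour `0` to the multiples of `D` and running through the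
colours `1, …, K` cyclically on the remaining numbers. -/
def spacedColour (K D x : ℕ) : ℕ :=
  if D ∣ x then 0 else Nat.count (fun y => ¬ D ∣ y) x % K + 1

theorem spacedColour_lt {K : ℕ} (hK : 0 < K) (D x : ℕ) : spacedColour K D x < K + 1 := by
  unfold spacedColour
  split_ifs
  · omega
  · have := Nat.mod_lt (Nat.count (fun y => ¬ D ∣ y) x) hK
    omega

theorem exists_lt_dvd_add {K r Q d i : ℕ} (hd : d = K)
    (hD' : Q * r < K + 1 + r) (hQ : 0 < Q) (hx' : ¬ Q * r ∣ i * r + d) :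
    ∃ y < d, Q * r ∣ i * r + y := by
  by_cases hb : i % Q = 0
  · by_cases hd0 : d = 0
    · exact absurd (by simpa [hd0] using Nat.mul_dvd_mul_right (Nat.dvd_of_mod_eq_zero hb) r) hx'
    · exact ⟨0, by omega, Nat.mul_dvd_mul_right (Nat.dvd_of_mod_eq_zero hb) r⟩
  · have hlt := Nat.mod_lt i hQ
    have hdvd : Q * r ∣ i * r + (Q - i % Q) * r := by
      rw [← add_mul]
      refine Nat.mul_dvd_mul_right ⟨i / Q + 1, ?_⟩ r
      have := Nat.mod_add_div i Q
      rw [mul_add]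
      omega
    have hle : (Q - i % Q) * r + r ≤ Q * r := by
      calc (Q - i % Q) * r + r = (Q - i % Q + 1) * r := by ring
        _ ≤ Q * r := Nat.mul_le_mul_right r (by omega)
    refine ⟨(Q - i % Q) * r, lt_of_le_of_ne (by omega) fun h => hx' ?_, hdvd⟩
    rwa [← h]

theorem spacedColour_ne {K r Q i j d : ℕ} (hD : K + 1 < Q * r) (hD' : Q * r < K + 1 + r)
    (hd : 0 < d) (hjd : j + d < K + 1) :
    spacedColour K (Q * r) (i * r + j) ≠ spacedColour K (Q * r) (i * r + j + d) := by
  have hQ : 0 < Q := Nat.pos_of_ne_zero (by rintro rfl; simp at hD)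
  unfold spacedColour
  by_cases hx : Q * r ∣ i * r + j
  · have : ¬ Q * r ∣ i * r + j + d := fun h =>
      absurd (Nat.le_of_dvd hd ((Nat.dvd_add_right hx).1 h)) (by omega)
    simp [hx, this]
  by_cases hx' : Q * r ∣ i * r + j + d
  · simp [hx, hx']
  rw [if_neg hx, if_neg hx', Nat.count_add _ (i * r + j) d, Ne, Nat.add_right_cancel_iff]
  set c := Nat.count (fun y => ¬ Q * r ∣ i * r + j + y) d with hc
  have hpos : 0 < c := by
    rw [hc, Nat.count_eq_card_filter_range, Finset.card_pos]
    exact ⟨0, by simpa [hd] using hx⟩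
  have hlt : c < K := by
    rcases Nat.lt_or_ge d K with hdK | hdK
    · exact (Nat.count_le _).trans_lt hdK
    · obtain rfl : j = 0 := by omega
      obtain ⟨y, hy, hdvd⟩ := exists_lt_dvd_add (by omega) hD' hQ hx'
      have hcd : c < d := by
        rw [hc, Nat.count_eq_card_filter_range]
        conv_rhs => rw [← Finset.card_range d]
        exact Finset.card_lt_card (Finset.filter_ssubset.2
          ⟨y, by simpa using hy, by simpa using hdvd⟩)
      omega
  intro h
  have h2 : Nat.count (fun y => ¬ Q * r ∣ y) (i * r + j) + 0 ≡
      Nat.count (fun y => ¬ Q * r ∣ y) (i * r + j) + c [MOD K] := h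
  exact absurd (Nat.le_of_dvd hpos
    ((Nat.modEq_zero_iff_dvd).1 (Nat.ModEq.add_left_cancel' _ h2).symm)) (by omega)

theorem abs_count_modEq_sub_le {r : ℕ} (hr : 0 < r) (v b : ℕ) :
    |(Nat.count (fun x => x ≡ v [MOD r]) b : ℝ) - b / r| ≤ 1 := by
  have hr' : (0 : ℝ) < r := by exact_mod_cast hr
  have hv : ((v % r : ℕ) : ℝ) / r < 1 := by
    rw [div_lt_one hr']; exact_mod_cast Nat.mod_lt v hr
  have hv0 : 0 ≤ ((v % r : ℕ) : ℝ) / r := by positivity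
  have h := Nat.count_modEq_card_eq_ceil b hr v
  have h1 : ((b : ℝ) - (v % r : ℕ)) / r ≤ Nat.count (fun x => x ≡ v [MOD r]) b := by
    have := Int.le_ceil (((b : ℚ) - (v % r : ℕ)) / r)
    rw [← h] at this
    exact_mod_cast this
  have h2 : (Nat.count (fun x => x ≡ v [MOD r]) b : ℝ) < ((b : ℝ) - (v % r : ℕ)) / r + 1 := by
    have := Int.ceil_lt_add_one (((b : ℚ) - (v % r : ℕ)) / r)
    rw [← h] at this
    exact_mod_cast this
  rw [sub_div] at h1 h2
  rw [abs_le]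
  constructor <;> linarith

theorem count_dvd_add_count_not_dvd (D X : ℕ) :
    Nat.count (fun y => D ∣ y) X + Nat.count (fun y => ¬ D ∣ y) X = X := by
  induction X with
  | zero => simp
  | succ X ih => rw [Nat.count_succ, Nat.count_succ]; split_ifs <;> omega

theorem count_spacedColour_zero (K D X : ℕ) :
    Nat.count (fun x => spacedColour K D x = 0) X = Nat.count (fun x => x ≡ 0 [MOD D]) X := by
  congr 1
  ext x
  rw [Nat.modEq_zero_iff_dvd, spacedColour]
  split_ifs <;> simp [*]

theorem count_spacedColour_succ {K v : ℕ} (hv : v < K) (D X : ℕ) :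
    Nat.count (fun x => spacedColour K D x = v + 1) X =
      Nat.count (fun x => x ≡ v [MOD K]) (Nat.count (fun y => ¬ D ∣ y) X) := by
  induction X with
  | zero => simp
  | succ X ih =>
    rw [Nat.count_succ, ih, Nat.count_succ _ X]
    by_cases h : D ∣ X
    · simp [spacedColour, h]
    · simp [spacedColour, h, Nat.count_succ, Nat.ModEq, Nat.mod_eq_of_lt hv]

theorem abs_count_spacedColour_zero_sub_le {D : ℕ} (hD : 0 < D) (K X : ℕ) :
    |(Nat.count (fun x => spacedColour K D x = 0) X : ℝ) - 1 / D * X| ≤ 2 := by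
  have := abs_count_modEq_sub_le hD 0 X
  rw [count_spacedColour_zero, one_div_mul_eq_div]
  linarith

theorem abs_count_spacedColour_succ_sub_le {K D v : ℕ} (hD : 0 < D) (hv : v < K) (X : ℕ) :
    |(Nat.count (fun x => spacedColour K D x = v + 1) X : ℝ) - (1 - 1 / D) / K * X| ≤ 2 := by
  rw [count_spacedColour_succ hv]
  have h1 := abs_count_modEq_sub_le (by omega : 0 < K) v (Nat.count (fun y => ¬ D ∣ y) X)
  have h2 := abs_count_modEq_sub_le hD 0 X
  simp only [Nat.modEq_zero_iff_dvd] at h2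
  have h3 : (Nat.count (fun y => D ∣ y) X : ℝ) + Nat.count (fun y => ¬ D ∣ y) X = X := by
    exact_mod_cast count_dvd_add_count_not_dvd D X
  generalize (Nat.count (fun x => x ≡ v [MOD K]) (Nat.count (fun y => ¬ D ∣ y) X) : ℝ) = A at *
  generalize (Nat.count (fun y => ¬ D ∣ y) X : ℝ) = B at *
  have hK : (1 : ℝ) ≤ K := by exact_mod_cast (by omega : 1 ≤ K)
  have h4 : |B / K - (1 - 1 / D) / K * X| ≤ 1 := by
    rw [show B / K - (1 - 1 / D) / K * X = -(Nat.count (fun y => D ∣ y) X - X / D) / (K : ℝ) by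
      rw [← h3]; ring, abs_div, abs_neg, Nat.abs_cast]
    exact (div_le_self (abs_nonneg _) hK).trans h2
  rw [abs_le] at *
  constructor <;> linarith

/-- The colouring of `ℕ` read off from a `t`-periodic sequence of windows. -/
def windowColour {k : ℕ} (W : ℕ → Equiv.Perm (Fin k)) (r t : ℕ) (hr : ∀ x, x % r < k) (x : ℕ) :
    Fin k :=
  W (x / r % t) ⟨x % r, hr x⟩

theorem windowColour_mod {k : ℕ} (W : ℕ → Equiv.Perm (Fin k)) (r t : ℕ) (hr : ∀ x, x % r < k)
    (x : ℕ) : windowColour W r t hr (x % (t * r)) = windowColour W r t hr x := by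
  simp only [windowColour, Nat.mod_mul_left_div_self, Nat.mod_mod,
    Nat.mod_mod_of_dvd x (dvd_mul_left r t)]

theorem windowColour_mul_add {k r t : ℕ} {W : ℕ → Equiv.Perm (Fin k)} (h0 : 0 < r) (ht : 0 < t)
    (hr : ∀ x, x % r < k) (hW0 : W t = W 0)
    (hW : ∀ i < t, ∀ j j' : Fin k, (j' : ℕ) = j + r → W (i + 1) j = W i j') (i : ℕ) (j : Fin k) :
    windowColour W r t hr (i * r + j) = W (i % t) j := by
  obtain ⟨j, hj⟩ := j
  induction j using Nat.strong_induction_on generalizing i with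
  | _ j ih =>
    rcases Nat.lt_or_ge j r with hjr | hjr
    · simp only [windowColour]
      congr 2
      · rw [add_comm, Nat.add_mul_div_right _ _ h0, Nat.div_eq_of_lt hjr, zero_add]
      · rw [add_comm, Nat.add_mul_mod_self_right, Nat.mod_eq_of_lt hjr]
    · have h1 := ih (j - r) (by omega) (i + 1) (by omega)
      have h2 : (i + 1) * r + (j - r) = i * r + j := by rw [add_mul]; omega
      simp only [h2] at h1
      have h3 := hW (i % t) (Nat.mod_lt _ ht) ⟨j - r, by omega⟩ ⟨j, hj⟩ (by simp; omega)
      have h4 : W ((i + 1) % t) = W (i % t + 1) := by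
        rw [Nat.add_mod_eq_ite]
        have := Nat.mod_lt i ht
        rcases Nat.lt_or_ge 1 t with h1t | h1t
        · rw [Nat.mod_eq_of_lt h1t]
          split_ifs with h
          · rw [show i % t + 1 = t by omega, hW0]; simp
          · rfl
        · obtain rfl : t = 1 := by omega
          simpa [Nat.mod_one] using hW0.symm
      simp only [h1, h4, h3]

theorem card_edge_inter_colour_class {k m : ℕ} [NeZero m] (F : ℕ → Fin k) (φ : Fin k → ZMod m)
    (σ : Equiv.Perm (Fin k)) (h : ∀ j, F (φ j).val = σ j) (c : Fin k) :
    (Finset.image φ Finset.univ ∩ Finset.univ.filter fun v : ZMod m => F v.val = c).card = 1 := by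
  rw [Finset.card_eq_one]
  refine ⟨φ (σ.symm c), ?_⟩
  ext v
  simp only [Finset.mem_inter, Finset.mem_image, Finset.mem_univ, true_and, Finset.mem_filter,
    Finset.mem_singleton]
  constructor
  · rintro ⟨⟨j, rfl⟩, hj⟩
    rw [← hj, h, Equiv.symm_apply_apply]
  · rintro rfl
    exact ⟨⟨_, rfl⟩, by rw [h, Equiv.apply_symm_apply]⟩

theorem card_filter_zmod_val {m : ℕ} [NeZero m] (p : ℕ → Prop) [DecidablePred p] :
    (Finset.univ.filter fun v : ZMod m => p v.val).card = Nat.count p m := by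
  rw [Nat.count_eq_card_filter_range]
  refine Finset.card_bij (fun v _ => v.val) ?_ ?_ ?_
  · intro v hv
    simpa [ZMod.val_lt] using hv
  · intro v _ v' _ h
    exact ZMod.val_injective m h
  · intro x hx
    simp only [Finset.mem_filter, Finset.mem_range] at hx
    exact ⟨x, by simp [ZMod.val_cast_of_lt hx.1, hx.2], ZMod.val_cast_of_lt hx.1⟩

theorem exists_spaced_windows {K r Q : ℕ} (hK : 0 < K) (hD : K + 1 < Q * r)
    (hD' : Q * r < K + 1 + r) :
    ∃ G : ℕ → Equiv.Perm (Fin (K + 1)),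
      ∀ i j, (G i j : ℕ) = spacedColour K (Q * r) (i * r + j) := by
  refine ⟨fun i => Equiv.ofBijective (fun j : Fin (K + 1) =>
    ⟨spacedColour K (Q * r) (i * r + j), spacedColour_lt hK _ _⟩)
      (Finite.injective_iff_bijective.1 ?_), fun i j => rfl⟩
  intro j j' h
  simp only [Fin.mk.injEq] at h
  by_contra hne
  rcases Nat.lt_or_gt_of_ne (fun h => hne (Fin.ext h) : (j : ℕ) ≠ j') with hlt | hlt
  · refine spacedColour_ne (i := i) (j := j) (d := j' - j) hD hD' (by omega) (by omega) ?_
    rw [add_assoc, Nat.add_sub_cancel' hlt.le]; exact h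
  · refine spacedColour_ne (i := i) (j := j') (d := j - j') hD hD' (by omega) (by omega) ?_
    rw [add_assoc, Nat.add_sub_cancel' hlt.le]; exact h.symm

/-- For some constant `L`, every `t ≥ L` admits a closed sequence of windows of length `t`
following the spaced colouring for the first `t - L` steps. -/
theorem exists_closed_windows {K r Q : ℕ} (h0 : 0 < r) (hr : r < K + 1) (hnd : ¬ r ∣ K + 1)
    (hD : K + 1 < Q * r) (hD' : Q * r < K + 1 + r) :
    ∃ L, ∀ n, ∃ W : ℕ → Equiv.Perm (Fin (K + 1)),
      W (n + L) = W 0 ∧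
      (∀ i < n + L, ∀ j j' : Fin (K + 1), (j' : ℕ) = j + r → W (i + 1) j = W i j') ∧
      ∀ i < n, ∀ j, (W i j : ℕ) = spacedColour K (Q * r) (i * r + j) := by
  obtain ⟨G, hG⟩ := exists_spaced_windows (by omega) hD hD'
  obtain ⟨L, hL⟩ := exists_connecting_length h0 hr hnd
  refine ⟨L, fun n => ?_⟩
  obtain ⟨w, hw0, hwL, hw⟩ := hL (G n) (G 0)
  have hWG : ∀ i ≤ n, (fun i => if i < n then G i else w (i - n)) i = G i := by
    intro i hi
    rcases hi.lt_or_eq with hi | rfl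
    · simp [hi]
    · simp [hw0]
  refine ⟨fun i => if i < n then G i else w (i - n), ?_, fun i hi j j' hj => ?_, fun i hi j => ?_⟩
  · rw [hWG 0 (Nat.zero_le _)]; simp [hwL]
  · rcases Nat.lt_or_ge i n with hin | hin
    · rw [hWG i hin.le, hWG (i + 1) hin]
      ext
      rw [hG, hG, hj]
      congr 1; ring
    · beta_reduce
      rw [if_neg hin.not_gt, if_neg (by omega), Nat.sub_add_comm hin]
      exact hw (i - n) (by omega) j j' hj
  · rw [hWG i hi.le]; exact hG i j

theorem count_le_count_add {p q : ℕ → Prop} [DecidablePred p] [DecidablePred q] {a b : ℕ}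
    (h : ∀ x < a, p x ↔ q x) :
    Nat.count q a ≤ Nat.count p (a + b) ∧ Nat.count p (a + b) ≤ Nat.count q a + b := by
  have h1 : Nat.count p a = Nat.count q a := by
    simp only [Nat.count_eq_card_filter_range]
    congr 1
    exact Finset.filter_congr fun x hx => h x (Finset.mem_range.1 hx)
  rw [Nat.count_add, h1]
  exact ⟨Nat.le_add_right _ _, Nat.add_le_add_left (Nat.count_le _) _⟩

theorem abs_div_sub_le {A C μ ε : ℝ} {n r L : ℕ} (hμ0 : 0 ≤ μ) (hμ1 : μ ≤ 1) (h0 : 0 < r)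
    (hε : 0 < ε) (hC : |C - μ * ((n * r : ℕ) : ℝ)| ≤ 2) (h1 : C ≤ A)
    (h2 : A ≤ C + ((L * r : ℕ) : ℝ)) (hn : (2 + ((L * r : ℕ) : ℝ)) / ε ≤ n + L) (hL : 0 < n + L) :
    |A / (((n + L) * r : ℕ) : ℝ) - μ| ≤ ε := by
  have hr : (1 : ℝ) ≤ r := by exact_mod_cast h0
  have hL' : (0 : ℝ) < n + L := by exact_mod_cast hL
  have hm : (0 : ℝ) < (n + L) * r := by positivity
  push_cast at *
  rw [div_le_iff₀ hε] at hn
  rw [div_sub' hm.ne', abs_div, abs_of_pos hm, div_le_iff₀ hm]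
  have h3 : 2 + (L : ℝ) * r ≤ ε * ((n + L) * r) := by nlinarith [mul_pos hε hL']
  have h4 : 0 ≤ μ * (L * r) := by positivity
  have h5 : μ * (L * r) ≤ L * r := mul_le_of_le_one_left (by positivity) hμ1
  rw [abs_le] at *
  constructor <;> nlinarith

theorem lt_ceil_mul {k r : ℕ} (h0 : 0 < r) (hnd : ¬ r ∣ k) : k < ⌈(k : ℝ) / r⌉₊ * r := by
  have hr : (0 : ℝ) < r := by exact_mod_cast h0
  have h := Nat.le_ceil ((k : ℝ) / r)
  rw [div_le_iff₀ hr] at h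
  refine lt_of_le_of_ne (by exact_mod_cast h) fun h' => hnd ⟨⌈(k : ℝ) / r⌉₊, ?_⟩
  rw [mul_comm]; exact h'

theorem ceil_mul_lt {k r : ℕ} (h0 : 0 < r) : ⌈(k : ℝ) / r⌉₊ * r < k + r := by
  have hr : (0 : ℝ) < r := by exact_mod_cast h0
  have h := Nat.ceil_lt_add_one (by positivity : 0 ≤ (k : ℝ) / r)
  rw [div_add_one hr.ne', lt_div_iff₀ hr] at h
  exact_mod_cast h


/-- **Corollary (space cycles).** Let `1 ≤ ℓ ≤ k - 1` with `k - ℓ ∤ k` and `ε > 0`.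
Then for all sufficiently large `t` there is a `k`-partite `k`-uniform `ℓ`-cycle on
`m = t(k-ℓ)` vertices with parts of sizes `α₁ m, …, α_k m`, where
`|α₁ - λ(k,ℓ)| ≤ ε` and `|α_i - (1 - λ(k,ℓ))/(k-1)| ≤ ε` for `2 ≤ i ≤ k`. -/
theorem kpartite_cycle_with_balanced_parts (k ℓ : ℕ) (hℓ1 : 1 ≤ ℓ) (hℓ2 : ℓ ≤ k - 1)
    (hnd : ¬ (k - ℓ) ∣ k) (ε : ℝ) (hε : 0 < ε) :
    ∃ t₀ : ℕ, ∀ t : ℕ, t₀ ≤ t →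
      ∃ P : Fin k → Finset (ZMod (t * (k - ℓ))),
        (∀ i j : Fin k, i ≠ j → Disjoint (P i) (P j)) ∧
        (∀ v : ZMod (t * (k - ℓ)), ∃ i : Fin k, v ∈ P i) ∧
        (∀ e ∈ cycleGraph k ℓ (t * (k - ℓ)), ∀ i : Fin k, (e ∩ P i).card = 1) ∧
        (∀ i : Fin k, (i : ℕ) = 0 →
          |((P i).card : ℝ) / ((t * (k - ℓ) : ℕ) : ℝ) - lam k ℓ| ≤ ε) ∧
        (∀ i : Fin k, (i : ℕ) ≠ 0 →
          |((P i).card : ℝ) / ((t * (k - ℓ) : ℕ) : ℝ) - (1 - lam k ℓ) / ((k : ℝ) - 1)| ≤ ε) := by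
  obtain ⟨K, rfl⟩ : ∃ K, k = K + 1 := ⟨k - 1, by omega⟩
  have hr : K + 1 - ℓ < K + 1 := by omega
  have h0 : 0 < K + 1 - ℓ := by omega
  unfold lam
  generalize hrℓ : K + 1 - ℓ = r at *
  have hK : 0 < K := by omega
  have hD := lt_ceil_mul h0 hnd
  have hD' := ceil_mul_lt (k := K + 1) h0
  rw [← Nat.cast_mul]
  generalize ⌈((K + 1 : ℕ) : ℝ) / (r : ℝ)⌉₊ = Q at *
  have hDpos : 0 < Q * r := by omega
  obtain ⟨L, hL⟩ := exists_closed_windows h0 hr hnd hD hD'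
  refine ⟨L + 1 + ⌈(2 + ((L * r : ℕ) : ℝ)) / ε⌉₊, fun t ht => ?_⟩
  obtain ⟨n, rfl⟩ : ∃ n, t = n + L := ⟨t - L, by omega⟩
  obtain ⟨W, hW0, hW, hWc⟩ := hL n
  have ht0 : 0 < n + L := by omega
  have hrk : ∀ x, x % r < K + 1 := fun x => (Nat.mod_lt x h0).trans hr
  have hbig : (2 + ((L * r : ℕ) : ℝ)) / ε ≤ n + L := by
    refine (Nat.le_ceil _).trans ?_
    exact_mod_cast (by omega : ⌈(2 + ((L * r : ℕ) : ℝ)) / ε⌉₊ ≤ n + L)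
  have : NeZero ((n + L) * r) := ⟨(Nat.mul_pos ht0 h0).ne'⟩
  set F := windowColour W r (n + L) hrk with hF
  have hFs : ∀ x < n * r, (F x : ℕ) = spacedColour K (Q * r) x := by
    intro x hx
    have hxn : x / r < n := (Nat.div_lt_iff_lt_mul h0).2 hx
    rw [hF, windowColour, Nat.mod_eq_of_lt (by omega : x / r < n + L), hWc _ hxn]
    congr 1
    exact Nat.div_add_mod' x r
  have hcount : ∀ c : Fin (K + 1), ∀ μ : ℝ, 0 ≤ μ → μ ≤ 1 →
      |(Nat.count (fun x => spacedColour K (Q * r) x = c) (n * r) : ℝ) -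
        μ * ((n * r : ℕ) : ℝ)| ≤ 2 →
      |((Finset.univ.filter fun v : ZMod ((n + L) * r) => F v.val = c).card : ℝ) /
        (((n + L) * r : ℕ) : ℝ) - μ| ≤ ε := by
    intro c μ hμ0 hμ1 hμ
    rw [card_filter_zmod_val (fun x => F x = c)]
    obtain ⟨h1, h2⟩ := count_le_count_add (p := fun x => F x = c)
      (q := fun x => spacedColour K (Q * r) x = c) (a := n * r) (b := L * r)
      (fun x hx => by rw [← hFs x hx, Fin.ext_iff])
    rw [← add_mul] at h1 h2
    exact abs_div_sub_le hμ0 hμ1 h0 hε hμ (by exact_mod_cast h1) (by exact_mod_cast h2) hbig ht0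
  have hDinv : (1 : ℝ) / (Q * r : ℕ) ≤ 1 :=
    div_le_one_of_le₀ (by exact_mod_cast hDpos) (by positivity)
  have hDinv0 : (0 : ℝ) ≤ 1 / (Q * r : ℕ) := by positivity
  refine ⟨fun c => Finset.univ.filter fun v => F v.val = c, ?_, ?_, ?_, ?_, ?_⟩
  · intro c c' hne
    rw [Finset.disjoint_filter]
    rintro v - rfl h
    exact hne h
  · exact fun v => ⟨F v.val, by simp⟩
  · intro e he c
    simp only [cycleGraph, Finset.mem_image] at he
    obtain ⟨i, -, rfl⟩ := he
    refine card_edge_inter_colour_class F _ (W (i % (n + L))) (fun j => ?_) c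
    rw [hrℓ, ZMod.val_natCast, hF, windowColour_mod, windowColour_mul_add h0 ht0 hrk hW0 hW]
  · intro c hc
    refine hcount c _ hDinv0 hDinv ?_
    rw [hc]
    exact abs_count_spacedColour_zero_sub_le hDpos K _
  · intro c hc
    obtain ⟨v, hv⟩ := Nat.exists_eq_succ_of_ne_zero hc
    rw [show ((K + 1 : ℕ) : ℝ) - 1 = K by push_cast; ring]
    refine hcount c _ (div_nonneg (by linarith) (by positivity)) ?_ ?_
    · exact div_le_one_of_le₀ (by
        have : (1 : ℝ) ≤ K := by exact_mod_cast hK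
        linarith) (by positivity)
    · rw [hv]
      exact abs_count_spacedColour_succ_sub_le hDpos (by omega) _
end

section
/- For all integers 1 ≤ ℓ ≤ k−2 with k−ℓ not dividing k, the perfect fractional ℓ-cycle tiling threshold satisfies δ_{k−1}^{frct}(k,ℓ) ≤ λ(k,ℓ), where λ(k,ℓ) = 1/(⌈k/(k−ℓ)⌉·(k−ℓ)). -/
/-- `φ : ZMod m → V` is a homomorphism from the `k`-uniform `ℓ`-cycle on `m`
vertices into the `k`-graph with edge set `E`. -/
def IsCycleHom (k ℓ m : ℕ) {V : Type} [DecidableEq V] (E : Finset (Finset V))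
    (φ : ZMod m → V) : Prop :=
  2 * k - ℓ ≤ m ∧ (k - ℓ) ∣ m ∧ ∀ e ∈ cycleGraph k ℓ m, e.image φ ∈ E

/-- A perfect fractional `ℓ`-cycle tiling of the `k`-graph with vertex set `verts`
and edge set `E`: a `[0,1]`-weighting of the homomorphisms from `ℓ`-cycles into the
graph such that every vertex receives total weight (counted with multiplicity of
preimages) exactly `1`. -/
def PerfectFracCycleTiling (k ℓ : ℕ) {V : Type} [DecidableEq V] (verts : Finset V)
    (E : Finset (Finset V)) : Prop :=
  ∃ ω : (Σ m : ℕ, ZMod m → V) → ℝ,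
    (∀ p, 0 ≤ ω p ∧ ω p ≤ 1) ∧
    (∀ p, ω p ≠ 0 → IsCycleHom k ℓ p.1 E p.2) ∧
    (∀ v ∈ verts,
      HasSum (fun p : Σ m : ℕ, ZMod m → V => ω p * ((p.2 ⁻¹' {v}).ncard : ℝ)) 1)

/-- `δ` is a valid constant for the minimum `d`-degree threshold for perfect
fractional `ℓ`-cycle tilings in `k`-graphs. -/
def FrcTilingProp (k ℓ d : ℕ) (δ : ℝ) : Prop :=
  ∀ ε : ℝ, 0 < ε → ∃ n₀ : ℕ, ∀ n : ℕ, n₀ ≤ n →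
    ∀ E : Finset (Finset (Fin n)), (∀ e ∈ E, e.card = k) →
      MinDegGe d E ((δ + ε) * ((n - d).choose (k - d) : ℝ)) →
      PerfectFracCycleTiling k ℓ (Finset.univ : Finset (Fin n)) E

/-- The minimum `d`-degree threshold `δ_d^{frct}(k,ℓ)` for perfect fractional
`ℓ`-cycle tilings in `k`-graphs. -/
noncomputable def frctThreshold (k ℓ d : ℕ) : ℝ :=
  sInf {δ : ℝ | 0 ≤ δ ∧ δ ≤ 1 ∧ FrcTilingProp k ℓ d δ}

/-- A periodic colouring of `ℕ` with colours below `a * d + r`.  Writing `x = q * d + s` with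
`s < d`, the colour records `s` together with `q` modulo `a + 1` or `a`, according to whether
`s < r`. -/
def blockColor (a d r x : ℕ) : ℕ :=
  (x / d % (if x % d < r then a + 1 else a)) * d + x % d

lemma blockColor_mul_add {a d r q s : ℕ} (hs : s < d) :
    blockColor a d r (q * d + s) = (q % (if s < r then a + 1 else a)) * d + s := by
  have hd : 0 < d := by omega
  have h1 : (q * d + s) / d = q := by
    rw [mul_comm, Nat.mul_add_div hd, Nat.div_eq_of_lt hs, add_zero]
  have h2 : (q * d + s) % d = s := by
    rw [mul_comm, Nat.mul_add_mod, Nat.mod_eq_of_lt hs]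
  rw [blockColor, h1, h2]

lemma mul_add_inj_of_lt {d q q' s s' : ℕ} (hs : s < d) (hs' : s' < d)
    (h : q * d + s = q' * d + s') : q = q' ∧ s = s' := by
  have hd : 0 < d := by omega
  have h1 := congrArg (· / d) h
  have h2 := congrArg (· % d) h
  simp only [mul_comm _ d, Nat.mul_add_div hd, Nat.div_eq_of_lt hs, Nat.div_eq_of_lt hs',
    Nat.mul_add_mod, Nat.mod_eq_of_lt hs, Nat.mod_eq_of_lt hs', add_zero] at h1 h2
  exact ⟨h1, h2⟩

lemma blockColor_lt {a d r : ℕ} (ha : 0 < a) (hd : 0 < d) (x : ℕ) :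
    blockColor a d r x < a * d + r := by
  have hs : x % d < d := Nat.mod_lt _ hd
  unfold blockColor
  split_ifs with h
  · have := Nat.mul_le_mul_right d (Nat.lt_succ_iff.1 (Nat.mod_lt (x / d) (Nat.succ_pos a)))
    simp only [Nat.succ_eq_add_one] at this
    omega
  · have := Nat.mul_le_mul_right d (Nat.succ_le_of_lt (Nat.mod_lt (x / d) ha))
    rw [Nat.succ_mul] at this
    omega

lemma blockColor_mod {a d r : ℕ} (x : ℕ) :
    blockColor a d r (x % (2 * a * (a + 1) * d)) = blockColor a d r x := by
  set N := 2 * a * (a + 1) with hN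
  have h1 : x % (N * d) / d = x / d % N := by
    rw [mul_comm N d, Nat.mod_mul_right_div_self]
  have h2 : x % (N * d) % d = x % d := Nat.mod_mul_left_mod x N d
  unfold blockColor
  rw [h1, h2]
  split_ifs
  · rw [Nat.mod_mod_of_dvd _ ⟨2 * a, by rw [hN]; ring⟩]
  · rw [Nat.mod_mod_of_dvd _ ⟨2 * (a + 1), by rw [hN]; ring⟩]

/-- Any `a * d + r` consecutive integers starting at a multiple of `d` receive distinct
colours. -/
lemma blockColor_injOn_window {a d r : ℕ} (hrd : r < d) (i : ℕ) {j j' : ℕ}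
    (hj : j < a * d + r) (hj' : j' < a * d + r)
    (h : blockColor a d r (i * d + j) = blockColor a d r (i * d + j')) : j = j' := by
  have hd : 0 < d := by omega
  obtain ⟨q, s, hs, rfl⟩ : ∃ q s, s < d ∧ j = q * d + s :=
    ⟨j / d, j % d, Nat.mod_lt _ hd, (Nat.div_add_mod' j d).symm⟩
  obtain ⟨q', s', hs', rfl⟩ : ∃ q s, s < d ∧ j' = q * d + s :=
    ⟨j' / d, j' % d, Nat.mod_lt _ hd, (Nat.div_add_mod' j' d).symm⟩
  rw [← add_assoc, ← add_mul, ← add_assoc, ← add_mul, blockColor_mul_add hs,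
    blockColor_mul_add hs'] at h
  obtain ⟨h1, rfl⟩ := mul_add_inj_of_lt hs hs' h
  have key : ∀ b, q < b → q' < b → (i + q) % b = (i + q') % b → q = q' := by
    intro b hq hq' hmod
    have : q ≡ q' [MOD b] := Nat.ModEq.add_left_cancel' i hmod
    exact this.eq_of_lt_of_lt hq hq'
  have hlt : ∀ p, p * d + s < a * d + r → p < (if s < r then a + 1 else a) := by
    intro p hp
    split_ifs with hsr
    · by_contra! hc
      have := Nat.mul_le_mul_right d hc
      rw [add_mul] at this
      omega
    · by_contra! hc
      have := Nat.mul_le_mul_right d hc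
      omega
  rw [key _ (hlt q hj) (hlt q' hj') h1]

/-- The colouring of the vertices of the cycle on `2 * a * (a + 1) * d` vertices. -/
def cycleColor (a d r : ℕ) (ha : 0 < a) (hd : 0 < d) (p : ZMod (2 * a * (a + 1) * d)) :
    Fin (a * d + r) :=
  ⟨blockColor a d r p.val, blockColor_lt ha hd _⟩

lemma val_cycleColor_natCast {a d r : ℕ} (ha : 0 < a) (hd : 0 < d) (x : ℕ) :
    (cycleColor a d r ha hd (x : ZMod (2 * a * (a + 1) * d)) : ℕ) = blockColor a d r x := by
  simp only [cycleColor, ZMod.val_natCast, blockColor_mod]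

lemma le_card_cycleColor_fiber {a d r : ℕ} (ha : 0 < a) (hd : 0 < d) (hrd : r < d)
    [NeZero (2 * a * (a + 1) * d)] (c : Fin (a * d + r)) :
    2 * a ≤ (Finset.univ.filter (fun p => cycleColor a d r ha hd p = c)).card := by
  obtain ⟨c, hc⟩ := c
  obtain ⟨q, s, hs, rfl⟩ : ∃ q s, s < d ∧ c = q * d + s :=
    ⟨c / d, c % d, Nat.mod_lt _ hd, (Nat.div_add_mod' c d).symm⟩
  set b := if s < r then a + 1 else a with hb
  have hba : b ≤ a + 1 := by rw [hb]; split_ifs <;> omega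
  have hb0 : 0 < b := by rw [hb]; split_ifs <;> omega
  have hqb : q < b := by
    rw [hb]
    split_ifs with hsr
    · by_contra! h
      have := Nat.mul_le_mul_right d h
      rw [add_mul] at this
      omega
    · by_contra! h
      have := Nat.mul_le_mul_right d h
      omega
  have hlt : ∀ j < 2 * a, (q + b * j) * d + s < 2 * a * (a + 1) * d := by
    intro j hj
    have h1 : q + b * j + 1 ≤ 2 * a * (a + 1) := by
      have : b * (j + 1) ≤ (a + 1) * (2 * a) := Nat.mul_le_mul hba hj
      nlinarith
    have h2 := Nat.mul_le_mul_right d h1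
    rw [add_mul (q + b * j) 1 d] at h2
    omega
  refine (Finset.card_range (2 * a)).ge.trans (Finset.card_le_card_of_injOn
    (fun j => (((q + b * j) * d + s : ℕ) : ZMod (2 * a * (a + 1) * d))) ?_ ?_)
  · intro j _
    simp only [Finset.coe_filter, Finset.mem_univ, true_and, Set.mem_ofPred_eq]
    apply Fin.ext
    rw [val_cycleColor_natCast, blockColor_mul_add hs, ← hb, Nat.add_mul_mod_self_left,
      Nat.mod_eq_of_lt hqb]
  · intro j hj j' hj' h
    simp only [Finset.coe_range, Set.mem_Iio] at hj hj'
    have h' := congrArg ZMod.val h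
    simp only [ZMod.val_natCast] at h'
    rw [Nat.mod_eq_of_lt (hlt j hj), Nat.mod_eq_of_lt (hlt j' hj')] at h'
    have := (mul_add_inj_of_lt hs hs h').1
    exact Nat.eq_of_mul_eq_mul_left hb0 (by omega)

lemma card_cycleColor_fiber_zero_le {a d r : ℕ} (ha : 0 < a) (hd : 0 < d) (hr : 0 < r)
    [NeZero (2 * a * (a + 1) * d)] :
    (Finset.univ.filter
      (fun p => cycleColor a d r ha hd p = ⟨0, by omega⟩)).card ≤ 2 * a := by
  have hsub : ∀ p : ZMod (2 * a * (a + 1) * d), cycleColor a d r ha hd p = ⟨0, by omega⟩ →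
      ∃ j, p.val = (a + 1) * d * j := by
    intro p hp
    have h0 : blockColor a d r p.val = 0 := congrArg Fin.val hp
    unfold blockColor at h0
    have h1 : p.val % d = 0 := by omega
    rw [h1, if_pos hr, add_zero, Nat.mul_eq_zero] at h0
    have h2 : p.val / d % (a + 1) = 0 := by omega
    obtain ⟨u, hu⟩ := Nat.dvd_of_mod_eq_zero h1
    rw [hu, Nat.mul_div_cancel_left _ hd] at h2
    obtain ⟨j, hj⟩ := Nat.dvd_of_mod_eq_zero h2
    exact ⟨j, by rw [hu, hj]; ring⟩
  have hpos : 0 < (a + 1) * d := by positivity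
  calc _ ≤ (Finset.range (2 * a)).card := by
        apply Finset.card_le_card_of_injOn (fun p => p.val / ((a + 1) * d))
        · intro p _
          simp only [Finset.coe_range, Set.mem_Iio]
          rw [Nat.div_lt_iff_lt_mul hpos, ← mul_assoc]
          exact ZMod.val_lt p
        · intro p hp p' hp' h
          simp only [Finset.coe_filter, Finset.mem_univ, true_and, Set.mem_ofPred_eq] at hp hp'
          obtain ⟨j, hj⟩ := hsub p hp
          obtain ⟨j', hj'⟩ := hsub p' hp'
          simp only [hj, hj', Nat.mul_div_cancel_left _ hpos] at h
          exact ZMod.val_injective _ (by rw [hj, hj', h])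
    _ = 2 * a := Finset.card_range _

/-- Wrapping the coloured cycle around an edge yields a homomorphism. -/
lemma isCycleHom_comp_cycleColor {V : Type} [DecidableEq V] {a d r k ℓ : ℕ} (ha : 0 < a)
    (hd : 0 < d) (hrd : r < d) (hk : k = a * d + r) (hkl : k - ℓ = d) (hlk : ℓ ≤ k)
    {E : Finset (Finset V)} (ψ : Fin (a * d + r) → V) (hE : Finset.univ.image ψ ∈ E) :
    IsCycleHom k ℓ (2 * a * (a + 1) * d) E (ψ ∘ cycleColor a d r ha hd) := by
  refine ⟨?_, ⟨2 * a * (a + 1), by rw [hkl]; ring⟩, ?_⟩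
  · have h1 : 2 * k - ℓ = k + d := by omega
    have h2 : 2 * (a + 1) * d ≤ 2 * a * (a + 1) * d :=
      Nat.mul_le_mul_right d (Nat.mul_le_mul_right _ (by omega))
    rw [h1, hk]
    nlinarith
  · intro e he
    obtain ⟨i, -, rfl⟩ := Finset.mem_image.1 he
    subst hk
    have hbij : Function.Bijective (fun j : Fin (a * d + r) =>
        cycleColor a d r ha hd (((i * d + (j : ℕ) : ℕ)) : ZMod (2 * a * (a + 1) * d))) := by
      rw [Finite.injective_iff_bijective.symm]
      intro j j' h
      have h' := congrArg Fin.val h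
      simp only [val_cycleColor_natCast] at h'
      exact Fin.ext (blockColor_injOn_window hrd i j.2 j'.2 h')
    rw [hkl, Finset.image_image]
    convert hE using 1
    ext v
    simp only [Finset.mem_image, Finset.mem_univ, true_and, Function.comp_apply]
    constructor
    · rintro ⟨j, rfl⟩
      exact ⟨_, rfl⟩
    · rintro ⟨c, rfl⟩
      obtain ⟨j, hj⟩ := hbij.2 c
      exact ⟨j, congrArg ψ hj⟩

lemma exists_card_eq_forall_le_of_notMem {n m : ℕ} (hm : m ≤ n) (y : Fin n → ℝ) :
    ∃ S : Finset (Fin n), S.card = m ∧ ∀ i ∈ S, ∀ j ∉ S, y i ≤ y j := by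
  induction m with
  | zero => exact ⟨∅, by simp⟩
  | succ m ih =>
    obtain ⟨S, hS, hle⟩ := ih (by omega)
    have hne : Sᶜ.Nonempty := by
      rw [← Finset.card_pos, Finset.card_compl, Fintype.card_fin]
      omega
    obtain ⟨x, hx, hmin⟩ := Finset.exists_min_image Sᶜ y hne
    rw [Finset.mem_compl] at hx
    refine ⟨insert x S, by rw [Finset.card_insert_of_notMem hx, hS], ?_⟩
    intro i hi j hj
    rw [Finset.mem_insert, not_or] at hj
    rcases Finset.mem_insert.1 hi with rfl | hi
    · exact hmin j (Finset.mem_compl.2 hj.2)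
    · exact hle i hi j hj.2

/-- If every homomorphism of the cycle has nonnegative total weight, then an edge consisting of
a set `S` of vertices of weight at most `s` and one further vertex of weight at least `s` is not
too light. -/
lemma neg_mul_le_sum_insert {n a d r k ℓ : ℕ} (ha : 0 < a) (hr : 0 < r) (hrd : r < d)
    (hk : k = a * d + r) (hkl : k - ℓ = d) (hlk : ℓ ≤ k) [NeZero (2 * a * (a + 1) * d)]
    {E : Finset (Finset (Fin n))} (hcard : ∀ e ∈ E, e.card = k) {y : Fin n → ℝ}
    (hy : ∀ φ : ZMod (2 * a * (a + 1) * d) → Fin n, IsCycleHom k ℓ _ E φ →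
      0 ≤ ∑ p, y (φ p))
    {S : Finset (Fin n)} {w : Fin n} (hwE : insert w S ∈ E) {s : ℝ} (hS : ∀ u ∈ S, y u ≤ s) :
    -(((a + 1 : ℕ) : ℝ) * d * s) ≤ ∑ u ∈ insert w S, (y u - s) := by
  have hd : 0 < d := by omega
  have hek : (insert w S).card = a * d + r := by rw [hcard _ hwE, hk]
  let z : Fin (a * d + r) := ⟨0, by omega⟩
  let ψ₀ := (Finset.equivFinOfCardEq hek).symm
  let w' : ↥(insert w S) := ⟨w, Finset.mem_insert_self _ _⟩
  let ψ : Fin (a * d + r) ≃ ↥(insert w S) := (Equiv.swap z (ψ₀.symm w')).trans ψ₀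
  have hz : (ψ z : Fin n) = w := by simp [ψ, w']
  have himg : Finset.univ.image (fun c => (ψ c : Fin n)) = insert w S := by
    ext v
    simp only [Finset.mem_image, Finset.mem_univ, true_and]
    constructor
    · rintro ⟨c, rfl⟩
      exact (ψ c).2
    · intro hv
      exact ⟨ψ.symm ⟨v, hv⟩, by simp⟩
  have hsum := hy _ (isCycleHom_comp_cycleColor ha hd hrd hk hkl hlk
    (fun c => (ψ c : Fin n)) (by rw [himg]; exact hwE))
  have hle : ∑ p : ZMod (2 * a * (a + 1) * d), (y (ψ (cycleColor a d r ha hd p)) - s) ≤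
      ∑ c, (2 * a : ℕ) * (y (ψ c) - s) := by
    rw [← Finset.sum_fiberwise (g := cycleColor a d r ha hd)]
    refine Finset.sum_le_sum fun c _ => ?_
    rw [Finset.sum_congr rfl (g := fun _ => y (ψ c) - s)
      (fun p hp => by rw [(Finset.mem_filter.1 hp).2]), Finset.sum_const, nsmul_eq_mul]
    have h1 := le_card_cycleColor_fiber ha hd hrd c
    by_cases hc : c = z
    · subst hc
      rw [le_antisymm (card_cycleColor_fiber_zero_le ha hd hr) h1]
    · refine mul_le_mul_of_nonpos_right (by exact_mod_cast h1) (sub_nonpos.2 (hS _ ?_))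
      refine Finset.mem_of_mem_insert_of_ne (ψ c).2 fun h => hc ?_
      exact ψ.injective (Subtype.ext (h.trans hz.symm))
  have hS' : ∑ c, (y (ψ c) - s) = ∑ u ∈ insert w S, (y u - s) := by
    rw [Equiv.sum_comp ψ (fun u => y u - s)]
    exact Finset.sum_coe_sort (insert w S) (fun u => y u - s)
  rw [Finset.sum_sub_distrib, ← Finset.mul_sum, hS', Finset.sum_const, Finset.card_univ,
    ZMod.card, nsmul_eq_mul] at hle
  simp only [Function.comp_apply] at hsum
  have ha' : (0 : ℝ) < a := by exact_mod_cast ha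
  push_cast at hle ⊢
  have : 2 * (a : ℝ) * (-((a + 1) * d * s)) ≤ 2 * a * ∑ u ∈ insert w S, (y u - s) := by
    linarith
  exact le_of_mul_le_mul_left this (by positivity)

lemma card_filter_superset_le {n k : ℕ} (hk : 0 < k) {E : Finset (Finset (Fin n))}
    (hcard : ∀ e ∈ E, e.card = k) {S : Finset (Fin n)} (hS : S.card = k - 1) :
    (E.filter (fun e => S ⊆ e)).card ≤
      (Sᶜ.filter (fun w => insert w S ∈ E)).card := by
  refine (Finset.card_le_card ?_).trans
    (Finset.card_image_le (s := Sᶜ.filter (fun w => insert w S ∈ E)) (f := fun w => insert w S))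
  intro e he
  obtain ⟨heE, hSe⟩ := Finset.mem_filter.1 he
  have h1 : (e \ S).card = 1 := by
    rw [Finset.card_sdiff_of_subset hSe, hcard e heE, hS]
    omega
  obtain ⟨w, hw⟩ := Finset.card_eq_one.1 h1
  have hws : w ∈ e \ S := by rw [hw]; exact Finset.mem_singleton_self w
  have hins : insert w S = e := by
    rw [Finset.insert_eq, ← hw, Finset.sdiff_union_of_subset hSe]
  exact Finset.mem_image.2 ⟨w, Finset.mem_filter.2
    ⟨Finset.mem_compl.2 (Finset.mem_sdiff.1 hws).2, hins ▸ heE⟩, hins⟩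

/-- The dual statement: a weighting which is nonnegative on every homomorphism of the cycle has
nonnegative total weight. -/
lemma sum_nonneg_of_cycleHom_nonneg {n a d r k ℓ : ℕ} (ha : 0 < a) (hr : 0 < r) (hrd : r < d)
    (hk : k = a * d + r) (hkl : k - ℓ = d) (hlk : ℓ ≤ k) [NeZero (2 * a * (a + 1) * d)]
    (hn : (a + 1) * d ≤ n) {E : Finset (Finset (Fin n))} (hcard : ∀ e ∈ E, e.card = k)
    (hdeg : ∀ S : Finset (Fin n), S.card = k - 1 →
      n ≤ (a + 1) * d * (E.filter (fun e => S ⊆ e)).card)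
    {y : Fin n → ℝ}
    (hy : ∀ φ : ZMod (2 * a * (a + 1) * d) → Fin n, IsCycleHom k ℓ _ E φ →
      0 ≤ ∑ p, y (φ p)) :
    0 ≤ ∑ v, y v := by
  have hda : d ≤ a * d := Nat.le_mul_of_pos_left d ha
  have hk1 : k ≤ (a + 1) * d := by rw [add_mul]; omega
  obtain ⟨S, hSc, hSle⟩ := exists_card_eq_forall_le_of_notMem (m := k - 1) (by omega) y
  have hSne : S.Nonempty := by rw [← Finset.card_pos]; omega
  obtain ⟨x, hxS, hxmax⟩ := Finset.exists_max_image S y hSne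
  set s := y x
  set N := Sᶜ.filter (fun w => insert w S ∈ E) with hN
  have hNn : n ≤ (a + 1) * d * N.card :=
    (hdeg S hSc).trans (Nat.mul_le_mul_left _ (card_filter_superset_le (by omega) hcard hSc))
  have hN1 : 1 ≤ N.card := by
    rw [Nat.one_le_iff_ne_zero]
    intro h0
    rw [h0] at hNn
    omega
  set Z := ∑ u ∈ S, (y u - s) with hZ
  have hZ0 : Z ≤ 0 := Finset.sum_nonpos fun u hu => sub_nonpos.2 (hxmax u hu)
  set D : ℝ := ((a + 1 : ℕ) : ℝ) * d with hD
  have hNw : ∀ w ∈ N, -(D * s) - Z ≤ y w - s := by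
    intro w hw
    obtain ⟨hwS, hwE⟩ := Finset.mem_filter.1 hw
    have := neg_mul_le_sum_insert ha hr hrd hk hkl hlk hcard hy hwE hxmax
    rw [Finset.sum_insert (Finset.mem_compl.1 hwS)] at this
    linarith
  have hout : ∀ w ∈ Sᶜ, 0 ≤ y w - s := fun w hw =>
    sub_nonneg.2 (hSle x hxS w (Finset.mem_compl.1 hw))
  have htot : ∑ v, y v = n * s + Z + ∑ w ∈ Sᶜ, (y w - s) := by
    rw [hZ, add_assoc, Finset.sum_add_sum_compl, Finset.sum_sub_distrib, Finset.sum_const,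
      Finset.card_univ, Fintype.card_fin, nsmul_eq_mul]
    ring
  have hsub : ∑ w ∈ N, (y w - s) ≤ ∑ w ∈ Sᶜ, (y w - s) :=
    Finset.sum_le_sum_of_subset_of_nonneg (Finset.filter_subset _ _) fun w hw _ => hout w hw
  have hNn' : (n : ℝ) ≤ D * N.card := by rw [hD]; exact_mod_cast hNn
  have hn' : D ≤ n := by rw [hD]; exact_mod_cast hn
  have hN1' : (1 : ℝ) ≤ N.card := by exact_mod_cast hN1
  rcases le_total s 0 with hs | hs
  · have h1 : N.card * (-(D * s) - Z) ≤ ∑ w ∈ N, (y w - s) := by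
      rw [← nsmul_eq_mul]
      exact Finset.card_nsmul_le_sum _ _ _ hNw
    nlinarith
  · obtain ⟨w, hw⟩ := Finset.card_pos.1 hN1
    have h1 : y w - s ≤ ∑ w ∈ N, (y w - s) :=
      Finset.single_le_sum (f := fun w => y w - s)
        (fun u hu => hout u (Finset.filter_subset _ _ hu)) hw
    have h2 := hNw w hw
    nlinarith

/-- Linear programming duality: if every weighting which is nonnegative on all homomorphisms of
the `ℓ`-cycle on `M` vertices has nonnegative total weight, then there is a perfect fractional
tiling. -/
lemma perfectFracCycleTiling_of_dual {k ℓ M n : ℕ} [NeZero M] (hn : 0 < n)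
    {E : Finset (Finset (Fin n))}
    (hdual : ∀ y : Fin n → ℝ, (∀ φ : ZMod M → Fin n, IsCycleHom k ℓ M E φ →
      0 ≤ ∑ p, y (φ p)) → 0 ≤ ∑ v, y v) :
    PerfectFracCycleTiling k ℓ (Finset.univ : Finset (Fin n)) E := by
  classical
  have hM : (0 : ℝ) < M := by exact_mod_cast Nat.pos_of_ne_zero (NeZero.ne M)
  have hn' : (0 : ℝ) < n := by exact_mod_cast hn
  let ι := {φ : ZMod M → Fin n // IsCycleHom k ℓ M E φ}
  let L : (ι → ℝ) →ₗ[ℝ] (Fin n → ℝ) :=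
    Fintype.linearCombination ℝ (fun φ v => ((φ.1 ⁻¹' {v}).ncard : ℝ))
  have hLapp : ∀ c v, L c v = ∑ φ : ι, c φ * ((φ.1 ⁻¹' {v}).ncard : ℝ) := by
    intro c v
    simp [L, Fintype.linearCombination_apply, Finset.sum_apply]
  have hmem : (fun _ => (M : ℝ) / n) ∈ L '' stdSimplex ℝ ι := by
    by_contra hnot
    have hclosed : IsClosed (L '' stdSimplex ℝ ι) :=
      ((isCompact_stdSimplex ℝ ι).image L.continuous_of_finiteDimensional).isClosed
    obtain ⟨f, u, hu, hf⟩ := geometric_hahn_banach_point_closed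
      ((convex_stdSimplex ℝ ι).linear_image L) hclosed hnot
    let y : Fin n → ℝ := fun v => f (fun j => if v = j then 1 else 0)
    have hfy : ∀ x, f x = ∑ v, x v * y v := by
      intro x
      simpa [y] using LinearMap.pi_apply_eq_sum_univ f.toLinearMap x
    have h1 : 0 ≤ ∑ v, (y v - u / M) := by
      refine hdual _ fun φ hφ => ?_
      have h2 := hf _ ⟨Pi.single ⟨φ, hφ⟩ 1, single_mem_stdSimplex ℝ _, rfl⟩
      have h3 : ∑ v, ((φ ⁻¹' {v}).ncard : ℝ) * y v = ∑ p, y (φ p) := by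
        rw [← Finset.sum_fiberwise (g := φ)]
        refine Finset.sum_congr rfl fun v _ => ?_
        rw [Finset.sum_congr rfl (g := fun _ => y v)
          (fun p hp => by rw [(Finset.mem_filter.1 hp).2]), Finset.sum_const, nsmul_eq_mul,
          ← Set.ncard_coe_finset]
        congr 3
        ext p
        simp
      have h4 : f (L (Pi.single ⟨φ, hφ⟩ 1)) = ∑ p, y (φ p) := by
        rw [hfy, ← h3]
        refine Finset.sum_congr rfl fun v _ => ?_
        rw [hLapp, Finset.sum_eq_single ⟨φ, hφ⟩ (fun b _ hb => by simp [hb])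
          (fun h => absurd (Finset.mem_univ _) h)]
        simp
      rw [Finset.sum_sub_distrib, Finset.sum_const, Finset.card_univ, ZMod.card, nsmul_eq_mul,
        mul_div_cancel₀ _ hM.ne']
      linarith
    rw [Finset.sum_sub_distrib, Finset.sum_const, Finset.card_univ, Fintype.card_fin,
      nsmul_eq_mul] at h1
    rw [hfy, ← Finset.mul_sum] at hu
    have h5 : (M : ℝ) / n * (n * (u / M)) = u := by field_simp
    have h6 : (M : ℝ) / n * (n * (u / M)) ≤ M / n * ∑ v, y v :=
      mul_le_mul_of_nonneg_left (by linarith) (by positivity)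
    linarith
  obtain ⟨c, ⟨hc0, -⟩, hc⟩ := hmem
  let g : (Σ m : ℕ, ZMod m → Fin n) → ℝ :=
    Function.extend (fun φ : ι => (⟨M, φ.1⟩ : Σ m : ℕ, ZMod m → Fin n))
      (fun φ => n / M * c φ) 0
  have hinj : Function.Injective (fun φ : ι => (⟨M, φ.1⟩ : Σ m : ℕ, ZMod m → Fin n)) := by
    intro φ φ' h
    exact Subtype.ext (eq_of_heq (Sigma.mk.inj h).2)
  have hg0 : ∀ p, 0 ≤ g p := by
    intro p
    by_cases hp : ∃ φ : ι, (⟨M, φ.1⟩ : Σ m : ℕ, ZMod m → Fin n) = p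
    · obtain ⟨φ, rfl⟩ := hp
      simp only [g, hinj.extend_apply]
      have := hc0 φ
      positivity
    · simp [g, Function.extend_apply' _ _ _ hp]
  have hne : ∀ p, g p ≠ 0 → ∃ φ : ι, (⟨M, φ.1⟩ : Σ m : ℕ, ZMod m → Fin n) = p := by
    intro p hp
    by_contra hcon
    exact hp (by simp [g, Function.extend_apply' _ _ _ hcon])
  have hsum : ∀ v : Fin n,
      HasSum (fun p : Σ m : ℕ, ZMod m → Fin n => g p * ((p.2 ⁻¹' {v}).ncard : ℝ)) 1 := by
    intro v
    rw [← hinj.hasSum_iff]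
    · have h1 := hasSum_fintype (fun φ : ι => n / M * c φ * ((φ.1 ⁻¹' {v}).ncard : ℝ))
      have h2 : ∑ φ : ι, n / M * c φ * ((φ.1 ⁻¹' {v}).ncard : ℝ) = 1 := by
        have h3 := congrFun hc v
        rw [hLapp] at h3
        simp only [mul_assoc]
        rw [← Finset.mul_sum, h3]
        field_simp
      rw [h2] at h1
      convert h1 using 2 with φ
      simp only [g, Function.comp_apply, hinj.extend_apply]
    · intro p hp
      by_cases h : g p = 0
      · rw [h, zero_mul]
      · exact absurd (hne p h) hp
  refine ⟨g, fun p => ⟨hg0 p, ?_⟩, ?_, fun v _ => hsum v⟩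
  · by_cases hp : g p = 0
    · rw [hp]
      exact zero_le_one
    obtain ⟨φ, rfl⟩ := hne p hp
    have h1 := le_hasSum (hsum (φ.1 0)) ⟨M, φ.1⟩
      (fun q _ => mul_nonneg (hg0 q) (Nat.cast_nonneg _))
    have h2 : (1 : ℝ) ≤ ((φ.1 ⁻¹' {φ.1 0}).ncard : ℝ) := by
      have : (φ.1 ⁻¹' {φ.1 0}).Nonempty := ⟨0, rfl⟩
      exact_mod_cast this.ncard_pos
    exact (le_mul_of_one_le_right (hg0 _) h2).trans h1
  · intro p hp
    obtain ⟨φ, rfl⟩ := hne p hp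
    exact φ.2

lemma lam_eq_one_div {k ℓ d r a : ℕ} (hr : 0 < r) (hrd : r < d) (hk : k = a * d + r)
    (hkl : k - ℓ = d) : lam k ℓ = 1 / (((a + 1 : ℕ) : ℝ) * d) := by
  have hd : (0 : ℝ) < d := by exact_mod_cast (hr.trans hrd)
  have hr' : (0 : ℝ) < r := by exact_mod_cast hr
  have hrd' : (r : ℝ) < d := by exact_mod_cast hrd
  have hceil : ⌈(k : ℝ) / (d : ℝ)⌉₊ = a + 1 := by
    rw [Nat.ceil_eq_iff (by omega), lt_div_iff₀ hd, div_le_iff₀ hd, hk]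
    push_cast [Nat.add_sub_cancel]
    constructor <;> nlinarith
  rw [lam, hkl, hceil]

lemma frcTilingProp_lam {k ℓ d r a : ℕ} (ha : 0 < a) (hr : 0 < r) (hrd : r < d)
    (hk : k = a * d + r) (hkl : k - ℓ = d) (hlk : ℓ ≤ k) :
    FrcTilingProp k ℓ (k - 1) (lam k ℓ) := by
  intro ε hε
  have hd : 0 < d := by omega
  have : NeZero (2 * a * (a + 1) * d) := ⟨by positivity⟩
  set D : ℝ := ((a + 1 : ℕ) : ℝ) * d with hD
  have hD0 : 0 < D := by positivity
  obtain ⟨n₁, hn₁⟩ := exists_nat_ge ((1 / D + ε) * k / ε)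
  refine ⟨max n₁ ((a + 1) * d + k), fun n hn E hcard hdeg => ?_⟩
  have hn1 : n₁ ≤ n := (le_max_left _ _).trans hn
  have hn2 : (a + 1) * d + k ≤ n := (le_max_right _ _).trans hn
  refine perfectFracCycleTiling_of_dual (M := 2 * a * (a + 1) * d) (by omega) fun y hy =>
    sum_nonneg_of_cycleHom_nonneg ha hr hrd hk hkl hlk (by omega) hcard (fun S hS => ?_) hy
  have h1 := hdeg S hS
  have hkk : k - (k - 1) = 1 := by omega
  rw [hkk, Nat.choose_one_right, lam_eq_one_div hr hrd hk hkl, ← hD] at h1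
  have h2 : ((n : ℝ) - k) ≤ ((n - (k - 1) : ℕ) : ℝ) := by
    rw [sub_le_iff_le_add]
    exact_mod_cast (by omega : n ≤ n - (k - 1) + k)
  have h3 : (1 / D + ε) * k ≤ ε * n := by
    have : (1 / D + ε) * k / ε ≤ n := hn₁.trans (by exact_mod_cast hn1)
    rw [div_le_iff₀ hε] at this
    linarith
  have h4 : (1 / D + ε) * ((n : ℝ) - k) ≤ (E.filter (fun e => S ⊆ e)).card :=
    (mul_le_mul_of_nonneg_left h2 (by positivity)).trans h1
  have h5 : 1 / D * n ≤ (E.filter (fun e => S ⊆ e)).card := by nlinarith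
  rw [div_mul_eq_mul_div, one_mul, div_le_iff₀ hD0] at h5
  rw [hD] at h5
  have h6 : (n : ℝ) ≤ (((a + 1) * d * (E.filter (fun e => S ⊆ e)).card : ℕ) : ℝ) := by
    push_cast at h5 ⊢
    linarith
  exact_mod_cast h6

/-- **Corollary.** For `1 ≤ ℓ ≤ k - 2` with `k - ℓ ∤ k`, we have
`δ_{k-1}^{frct}(k,ℓ) ≤ λ(k,ℓ)`. -/
theorem frctThreshold_codegree_le_lam (k ℓ : ℕ) (hℓ1 : 1 ≤ ℓ) (hℓ2 : ℓ ≤ k - 2)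
    (hnd : ¬ (k - ℓ) ∣ k) :
    frctThreshold k ℓ (k - 1) ≤ lam k ℓ := by
  have hd : 0 < k - ℓ := by omega
  have ha : 0 < k / (k - ℓ) := Nat.div_pos (by omega) hd
  have hr : 0 < k % (k - ℓ) := Nat.pos_of_ne_zero fun h => hnd (Nat.dvd_of_mod_eq_zero h)
  have hrd : k % (k - ℓ) < k - ℓ := Nat.mod_lt _ hd
  have hk : k = k / (k - ℓ) * (k - ℓ) + k % (k - ℓ) := (Nat.div_add_mod' _ _).symm
  refine csInf_le ⟨0, fun δ hδ => hδ.1⟩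
    ⟨?_, ?_, frcTilingProp_lam ha hr hrd hk rfl (by omega)⟩
  · rw [lam]
    positivity
  · rw [lam_eq_one_div hr hrd hk rfl]
    refine div_le_one_of_le₀ ?_ (by positivity)
    exact_mod_cast Nat.mul_pos (Nat.succ_pos _) hd
end

section
/- For all integers k ≥ 3 and 1 ≤ ℓ ≤ k−2 with k−ℓ not dividing k, the perfect fractional ℓ-cycle tiling threshold satisfies δ_{k−2}^{frct}(k,ℓ) ≤ 1 − (1 − λ(k,ℓ))², where λ(k,ℓ) = 1/(⌈k/(k−ℓ)⌉·(k−ℓ)). -/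
/-- Among the pairs contained in a vertex set `W`, those covered by a fractional vertex cover `x`
of total weight less than `L` number at most `L * |W| - L ^ 2 / 2`, provided `L ≤ 2 * |W| / 5`. -/
theorem two_mul_card_le_of_fractional_cover {V : Type*} [DecidableEq V] (W : Finset V) (x : V → ℝ)
    (L : ℝ) (hx : ∀ v ∈ W, 0 ≤ x v) (hsum : ∑ v ∈ W, x v < L) (hL : 5 * L ≤ 2 * W.card)
    (P : Finset (Finset V)) (hP : P ⊆ W.powersetCard 2)
    (hcov : ∀ a b, a ≠ b → {a, b} ∈ P → 1 ≤ x a + x b) :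
    2 * (P.card : ℝ) ≤ 2 * L * W.card - L ^ 2 := by
  classical
  obtain ⟨θ, hθ0, hθ1, hθ⟩ : ∃ θ : ℝ, 0 < θ ∧ θ ≤ 1 / 2 ∧
      ((W.filter (fun v => 1 - θ < x v)).card : ℝ) + (W.filter (fun v => θ ≤ x v)).card
        ≤ 2 * L := by
    by_contra! hcon
    have hint : ∀ v, IntervalIntegrable
        (fun θ : ℝ => (if 1 - θ < x v then (1 : ℝ) else 0) + (if θ ≤ x v then (1 : ℝ) else 0))
        MeasureTheory.volume 0 (1 / 2) := by
      intro v
      apply IntervalIntegrable.add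
      · apply Monotone.intervalIntegrable
        intro a b hab
        dsimp only
        split_ifs <;> first | (norm_num; done) | (exfalso; linarith)
      · apply Antitone.intervalIntegrable
        intro a b hab
        dsimp only
        split_ifs <;> first | (norm_num; done) | (exfalso; linarith)
    have hle : ∀ v ∈ W, ∫ θ in (0 : ℝ)..(1 / 2),
        ((if 1 - θ < x v then (1 : ℝ) else 0) + (if θ ≤ x v then (1 : ℝ) else 0)) ≤ x v := by
      intro v hv
      have h0 := hx v hv
      rcases le_total (x v) (1 / 2) with h | h
      · have h1 : ∫ θ in (0 : ℝ)..(1 / 2),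
            ((if 1 - θ < x v then (1 : ℝ) else 0) + (if θ ≤ x v then (1 : ℝ) else 0))
            = (∫ θ in (0 : ℝ)..(x v), (1 : ℝ)) + ∫ θ in (x v)..(1 / 2), (0 : ℝ) := by
          rw [← intervalIntegral.integral_add_adjacent_intervals (b := x v)
            ((hint v).mono_set (by
              rw [Set.uIcc_of_le h0, Set.uIcc_of_le (by norm_num)]
              exact Set.Icc_subset_Icc le_rfl h))
            ((hint v).mono_set (by
              rw [Set.uIcc_of_le h, Set.uIcc_of_le (by norm_num)]
              exact Set.Icc_subset_Icc h0 le_rfl))]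
          congr 1
          · apply intervalIntegral.integral_congr_ae
            refine MeasureTheory.ae_of_all _ fun θ hθ => ?_
            rw [Set.uIoc_of_le h0] at hθ
            rw [if_neg (by linarith [hθ.1, hθ.2]), if_pos hθ.2, zero_add]
          · apply intervalIntegral.integral_congr_ae
            refine MeasureTheory.ae_of_all _ fun θ hθ => ?_
            rw [Set.uIoc_of_le h] at hθ
            rw [if_neg (by linarith [hθ.1, hθ.2]), if_neg (by linarith [hθ.1]), zero_add]
        rw [h1]; simp
      · rcases le_total (x v) 1 with h' | h'
        · have h1 : ∫ θ in (0 : ℝ)..(1 / 2),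
              ((if 1 - θ < x v then (1 : ℝ) else 0) + (if θ ≤ x v then (1 : ℝ) else 0))
              = (∫ θ in (0 : ℝ)..(1 - x v), (1 : ℝ)) + ∫ θ in (1 - x v)..(1 / 2), (2 : ℝ) := by
            rw [← intervalIntegral.integral_add_adjacent_intervals (b := 1 - x v)
              ((hint v).mono_set (by
                rw [Set.uIcc_of_le (by linarith), Set.uIcc_of_le (by norm_num)]
                exact Set.Icc_subset_Icc le_rfl (by linarith)))
              ((hint v).mono_set (by
                rw [Set.uIcc_of_le (by linarith), Set.uIcc_of_le (by norm_num)]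
                exact Set.Icc_subset_Icc (by linarith) le_rfl))]
            congr 1
            · apply intervalIntegral.integral_congr_ae
              refine MeasureTheory.ae_of_all _ fun θ hθ => ?_
              rw [Set.uIoc_of_le (by linarith)] at hθ
              rw [if_neg (by linarith [hθ.2]), if_pos (by linarith [hθ.2]), zero_add]
            · apply intervalIntegral.integral_congr_ae
              refine MeasureTheory.ae_of_all _ fun θ hθ => ?_
              rw [Set.uIoc_of_le (by linarith)] at hθ
              rw [if_pos (by linarith [hθ.1]), if_pos (by linarith [hθ.2])]
              norm_num
          rw [h1]; simp; linarith
        · calc _ ≤ ∫ θ in (0 : ℝ)..(1 / 2), (2 : ℝ) := by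
                apply intervalIntegral.integral_mono_on (by norm_num) (hint v) (by simp)
                intro θ _
                split_ifs <;> norm_num
            _ = 1 := by simp
            _ ≤ x v := h'
    have h2 : ∫ θ in (0 : ℝ)..(1 / 2), ∑ v ∈ W,
        ((if 1 - θ < x v then (1 : ℝ) else 0) + (if θ ≤ x v then (1 : ℝ) else 0))
        ≤ ∑ v ∈ W, x v := by
      rw [intervalIntegral.integral_finsetSum (fun v _ => hint v)]
      exact Finset.sum_le_sum hle
    have h3 : ∫ θ in (0 : ℝ)..(1 / 2), 2 * L ≤ ∫ θ in (0 : ℝ)..(1 / 2), ∑ v ∈ W,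
        ((if 1 - θ < x v then (1 : ℝ) else 0) + (if θ ≤ x v then (1 : ℝ) else 0)) := by
      apply intervalIntegral.integral_mono_on_of_le_Ioo (by norm_num) (by simp)
      · have := IntervalIntegrable.sum W (fun v _ => hint v)
        simpa only [Finset.sum_fn] using this
      · intro θ hθ
        have := hcon θ hθ.1 hθ.2.le
        rw [Finset.sum_add_distrib, Finset.sum_boole, Finset.sum_boole]
        exact this.le
    have h4 : ∫ θ in (0 : ℝ)..(1 / 2), 2 * L = L := by simp
    linarith
  set A := W.filter (fun v => 1 - θ < x v) with hA
  set B := W.filter (fun v => θ ≤ x v ∧ x v ≤ 1 - θ) with hB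
  have hAB : (W.filter (fun v => θ ≤ x v)).card = A.card + B.card := by
    rw [← Finset.card_union_of_disjoint]
    · congr 1
      ext v
      simp only [hA, hB, Finset.mem_filter, Finset.mem_union]
      constructor
      · rintro ⟨h1, h2⟩
        rcases lt_or_ge (1 - θ) (x v) with h | h
        · exact Or.inl ⟨h1, h⟩
        · exact Or.inr ⟨h1, h2, h⟩
      · rintro (⟨h1, h2⟩ | ⟨h1, h2, -⟩)
        · exact ⟨h1, by linarith⟩
        · exact ⟨h1, h2⟩
    · rw [Finset.disjoint_left]
      intro v h1 h2
      simp only [hA, hB, Finset.mem_filter] at h1 h2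
      linarith [h1.2, h2.2.2]
  have hsub : P ⊆ (W.powersetCard 2 \ (W \ A).powersetCard 2) ∪ B.powersetCard 2 := by
    intro e he
    have heW := hP he
    obtain ⟨hW, hc⟩ := Finset.mem_powersetCard.1 heW
    rw [Finset.mem_union, Finset.mem_sdiff]
    by_cases h : e ∈ (W \ A).powersetCard 2
    · right
      obtain ⟨h1, -⟩ := Finset.mem_powersetCard.1 h
      refine Finset.mem_powersetCard.2 ⟨?_, hc⟩
      obtain ⟨a, b, hab, rfl⟩ := Finset.card_eq_two.1 hc
      have hcv := hcov a b hab he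
      have ha := h1 (show a ∈ ({a, b} : Finset V) by simp)
      have hb := h1 (show b ∈ ({a, b} : Finset V) by simp)
      simp only [hA, Finset.mem_sdiff, Finset.mem_filter, not_and, not_lt] at ha hb
      have ha2 := ha.2 ha.1
      have hb2 := hb.2 hb.1
      intro v hv
      simp only [Finset.mem_insert, Finset.mem_singleton] at hv
      rcases hv with rfl | rfl
      · exact Finset.mem_filter.2 ⟨ha.1, by linarith, ha2⟩
      · exact Finset.mem_filter.2 ⟨hb.1, by linarith, hb2⟩
    · exact Or.inl ⟨heW, h⟩
  have hcard := (Finset.card_le_card hsub).trans (Finset.card_union_le _ _)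
  have hAW : A ⊆ W := Finset.filter_subset _ _
  rw [Finset.card_sdiff_of_subset (Finset.powersetCard_mono Finset.sdiff_subset),
    Finset.card_powersetCard, Finset.card_powersetCard, Finset.card_powersetCard,
    Finset.card_sdiff_of_subset hAW] at hcard
  have hAle := Finset.card_le_card hAW
  have hcard' : (P.card : ℝ) + ((W.card - A.card).choose 2 : ℕ)
      ≤ (W.card.choose 2 : ℕ) + (B.card.choose 2 : ℕ) := by
    have := Nat.choose_le_choose 2 (Nat.sub_le W.card A.card)
    exact_mod_cast (by omega : P.card + (W.card - A.card).choose 2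
      ≤ W.card.choose 2 + B.card.choose 2)
  rw [Nat.cast_choose_two, Nat.cast_choose_two, Nat.cast_choose_two, Nat.cast_sub hAle] at hcard'
  rw [hAB] at hθ
  push_cast at hθ
  have hA0 : (0 : ℝ) ≤ A.card := Nat.cast_nonneg _
  have hB0 : (0 : ℝ) ≤ B.card := Nat.cast_nonneg _
  generalize (A.card : ℝ) = a at *
  generalize (B.card : ℝ) = b at *
  generalize (W.card : ℝ) = N at *
  generalize (P.card : ℝ) = p at *
  have hb : b ^ 2 ≤ (2 * (L - a)) ^ 2 := pow_le_pow_left₀ hB0 (by linarith) 2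
  have hprod : 0 ≤ (L - a) * (2 * N - 5 * L + 3 * a) :=
    mul_nonneg (by linarith) (by linarith)
  nlinarith

/-- Linear programming duality for fractional tilings by homomorphic images of the `ℓ`-cycle on
`m` vertices. -/
theorem perfectFracCycleTiling_of_forall_weight {k ℓ m n : ℕ} [NeZero m] (hn : 0 < n)
    (E : Finset (Finset (Fin n)))
    (h : ∀ y : Fin n → ℝ, (∀ φ : ZMod m → Fin n, IsCycleHom k ℓ m E φ → 0 ≤ ∑ p, y (φ p)) →
      0 ≤ ∑ v, y v) :
    PerfectFracCycleTiling k ℓ (Finset.univ : Finset (Fin n)) E := by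
  classical
  have hm : (0 : ℝ) < m := Nat.cast_pos.2 (Nat.pos_of_ne_zero (NeZero.ne m))
  have hn' : (0 : ℝ) < n := Nat.cast_pos.2 hn
  let H := {φ : ZMod m → Fin n // IsCycleHom k ℓ m E φ}
  let c : H → Fin n → ℝ := fun φ v => ∑ p, if φ.1 p = v then 1 else 0
  let T : (H → ℝ) →ₗ[ℝ] (Fin n → ℝ) := Fintype.linearCombination ℝ c
  have hT : ∀ w v, T w v = ∑ φ, w φ * c φ v := by
    intro w v
    simp [T, Fintype.linearCombination_apply]
  have hcy : ∀ (y : Fin n → ℝ) (φ : H), ∑ v, c φ v * y v = ∑ p, y (φ.1 p) := by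
    intro y φ
    simp only [c, Finset.sum_mul]
    rw [Finset.sum_comm]
    simp
  have hmem : (fun _ => (m : ℝ) / n) ∈ T '' stdSimplex ℝ H := by
    by_contra hnot
    obtain ⟨f, u, hfu, hfK⟩ := geometric_hahn_banach_point_closed
      ((convex_stdSimplex ℝ H).linear_image T)
      (((isCompact_stdSimplex ℝ H).image T.continuous_of_finiteDimensional).isClosed) hnot
    have hf : ∀ z : Fin n → ℝ, f z = ∑ v, z v * f (Pi.single v 1) := by
      intro z
      have := LinearMap.pi_apply_eq_sum_univ (f : (Fin n → ℝ) →ₗ[ℝ] ℝ) z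
      have hsingle : ∀ v, (Pi.single v (1 : ℝ) : Fin n → ℝ) = fun j => if v = j then 1 else 0 := by
        intro v
        ext j
        simp [Pi.single_apply, eq_comm]
      simp only [hsingle]
      simpa using this
    have key := h (fun v => f (Pi.single v 1) - u / m) (by
      intro φ hφ
      have h1 := hfK (T (Pi.single ⟨φ, hφ⟩ 1)) ⟨_, single_mem_stdSimplex ℝ _, rfl⟩
      have h2 : T (Pi.single ⟨φ, hφ⟩ 1) = c ⟨φ, hφ⟩ := by
        simp [T]
      rw [h2, hf, hcy (fun v => f (Pi.single v 1))] at h1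
      rw [Finset.sum_sub_distrib]
      simp only [Finset.sum_const, Finset.card_univ, ZMod.card, nsmul_eq_mul]
      rw [mul_div_cancel₀ _ hm.ne']
      linarith)
    rw [hf, ← Finset.mul_sum] at hfu
    rw [Finset.sum_sub_distrib] at key
    simp only [Finset.sum_const, Finset.card_univ, Fintype.card_fin, nsmul_eq_mul] at key
    generalize ∑ v, f (Pi.single v 1) = σ at *
    have : (m : ℝ) / n * (n * (u / m)) = u := by field_simp
    nlinarith [mul_nonneg (div_pos hm hn').le key]
  obtain ⟨w, ⟨hw0, -⟩, hw⟩ := hmem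
  let ι : H → (Σ m : ℕ, ZMod m → Fin n) := fun φ => ⟨m, φ.1⟩
  have hι : Function.Injective ι := fun a b hab =>
    Subtype.ext (sigma_mk_injective hab)
  have hcount : ∀ (φ : H) v, (((φ.1 ⁻¹' {v}).ncard : ℕ) : ℝ) = c φ v := by
    intro φ v
    simp only [c, Finset.sum_boole]
    rw [Set.ncard_eq_toFinset_card']
    congr 2
    ext p
    simp
  have hc0 : ∀ φ v, 0 ≤ c φ v := fun φ v => by rw [← hcount]; positivity
  have hsum : ∀ v, ∑ φ, (n / m * w φ) * c φ v = 1 := by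
    intro v
    have := congrFun hw v
    rw [hT] at this
    simp only [mul_assoc]
    rw [← Finset.mul_sum, this]
    field_simp
  have hW0 : ∀ φ, 0 ≤ n / m * w φ := fun φ => mul_nonneg (by positivity) (hw0 φ)
  refine ⟨Function.extend ι (fun φ => n / m * w φ) 0, ?_, ?_, ?_⟩
  · intro p
    by_cases hp : ∃ φ, ι φ = p
    · obtain ⟨φ, rfl⟩ := hp
      rw [hι.extend_apply]
      refine ⟨hW0 φ, ?_⟩
      have h1 : 1 ≤ c φ (φ.1 0) := by
        have := Finset.single_le_sum (s := Finset.univ)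
          (f := fun p => if φ.1 p = φ.1 0 then (1 : ℝ) else 0)
          (fun p _ => by split_ifs <;> norm_num) (Finset.mem_univ 0)
        simpa [c] using this
      have h2 := Finset.single_le_sum (s := Finset.univ)
        (f := fun ψ => (n / m * w ψ) * c ψ (φ.1 0))
        (fun ψ _ => mul_nonneg (hW0 ψ) (hc0 ψ _)) (Finset.mem_univ φ)
      rw [hsum] at h2
      nlinarith [hW0 φ]
    · rw [Function.extend_apply' _ _ _ hp]
      simp
  · intro p hp
    by_cases hp' : ∃ φ, ι φ = p
    · obtain ⟨φ, rfl⟩ := hp'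
      exact φ.2
    · rw [Function.extend_apply' _ _ _ hp'] at hp
      simp at hp
  · intro v _
    rw [← hι.hasSum_iff]
    · have := hasSum_fintype (fun φ : H => (n / m * w φ) * c φ v)
      rw [hsum] at this
      convert this using 2 with φ
      simp only [Function.comp_apply]
      rw [hι.extend_apply, ← hcount]
    · intro p hp
      rw [Function.extend_apply' _ _ _ (by simpa using hp)]
      simp

/-- A colouring of the `ℓ`-cycle on `m` vertices with `k` colours in which every edge is rainbow
and two of the colours have density only `1 / ((u + 1) * (k - ℓ))`, where `k = u * (k - ℓ) + r`. -/
theorem exists_rainbow_cycle_colouring (k ℓ s u r : ℕ) (hk : 3 ≤ k) (hs : s = k - ℓ) (hu : 1 ≤ u)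
    (hr : 0 < r) (hrs : r < s) (hkur : k = u * s + r) :
    ∃ m : ℕ, 0 < m ∧ 2 * k - ℓ ≤ m ∧ (k - ℓ) ∣ m ∧
      ∃ c : ZMod m → Fin (k - 2) ⊕ Fin 2,
        (∀ e ∈ cycleGraph k ℓ m, e.image c = Finset.univ) ∧
        ∀ i : Fin 2, ((c ⁻¹' {Sum.inr i}).ncard) * ((u + 1) * s) = m := by
  classical
  have hsk : s + ℓ = k := by
    have : 0 < k - ℓ := by omega
    omega
  let C : Finset (ℕ × ℕ) :=
    (Finset.range r ×ˢ Finset.range (u + 1)) ∪ (Finset.Ico r s ×ˢ Finset.range u)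
  have hC : C.card = k := by
    rw [Finset.card_union_of_disjoint]
    · simp only [Finset.card_product, Finset.card_range, Nat.card_Ico]
      rw [hkur]
      obtain ⟨d, rfl⟩ := Nat.exists_eq_add_of_lt hrs
      have : r + d + 1 - r = d + 1 := by omega
      rw [this]; ring
    · rw [Finset.disjoint_left]
      rintro ⟨a, b⟩ h1 h2
      simp only [Finset.mem_product, Finset.mem_range, Finset.mem_Ico] at h1 h2
      omega
  let c₀ : ℕ → ℕ × ℕ := fun n =>
    if n % s < r then (n % s, n / s % (u + 1)) else (n % s, n / s % u)
  have hc₀ : ∀ n, c₀ n ∈ C := by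
    intro n
    have h1 := Nat.mod_lt (n / s) (Nat.succ_pos u)
    have h2 := Nat.mod_lt (n / s) hu
    have h3 := Nat.mod_lt n (hr.trans hrs)
    simp only [c₀, C]
    split_ifs with h
    · simp only [Finset.mem_union, Finset.mem_product, Finset.mem_range, Finset.mem_Ico]
      left; exact ⟨h, h1⟩
    · simp only [Finset.mem_union, Finset.mem_product, Finset.mem_range, Finset.mem_Ico]
      right; exact ⟨⟨not_lt.1 h, h3⟩, h2⟩
  obtain ⟨g, hg⟩ := Finset.exists_equiv_extend_of_card_eq (α := Fin (k - 2) ⊕ Fin 2) (t := C)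
    (by simp [hC]; omega) (s := {Sum.inr 0, Sum.inr 1})
    (f := fun x => Sum.elim (fun _ => (0, 0)) (fun i : Fin 2 => (0, (i : ℕ))) x)
    (by
      intro x hx
      simp only [Finset.image_insert, Finset.image_singleton, Finset.mem_insert,
        Finset.mem_singleton, Sum.elim_inr] at hx
      simp only [C, Finset.mem_union, Finset.mem_product, Finset.mem_range]
      left
      rcases hx with rfl | rfl <;> simp <;> omega)
    (by
      intro a ha b hb hab
      simp only [Finset.coe_insert, Finset.coe_singleton, Set.mem_insert_iff,
        Set.mem_singleton_iff] at ha hb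
      rcases ha with rfl | rfl <;> rcases hb with rfl | rfl <;> simp at hab ⊢)
  have hgi : ∀ i : Fin 2, (g (Sum.inr i) : ℕ × ℕ) = (0, (i : ℕ)) := by
    intro i
    have := hg (Sum.inr i) (by fin_cases i <;> simp)
    simpa using this
  have hs0 : 0 < s := hr.trans hrs
  let K := 2 * (u * (u + 1))
  have hK : 0 < K := by positivity
  let m := s * K
  have hm : 0 < m := Nat.mul_pos hs0 hK
  have : NeZero m := ⟨hm.ne'⟩
  have hper : ∀ n, c₀ (n % m) = c₀ n := by
    intro n
    have h1 : n % m % s = n % s := Nat.mod_mod_of_dvd _ ⟨K, rfl⟩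
    have h2 : n % m / s = n / s % K := Nat.mod_mul_right_div_self _ _ _
    have h3 : n / s % K % (u + 1) = n / s % (u + 1) :=
      Nat.mod_mod_of_dvd _ ⟨2 * u, by simp only [K]; ring⟩
    have h4 : n / s % K % u = n / s % u :=
      Nat.mod_mod_of_dvd _ ⟨2 * (u + 1), by simp only [K]; ring⟩
    simp only [c₀, h1, h2, h3, h4]
  refine ⟨m, hm, ?_, hs ▸ ⟨K, rfl⟩, fun p => g.symm ⟨c₀ p.val, hc₀ _⟩, ?_, ?_⟩
  · have h1 : 2 * k - ℓ = (u + 1) * s + r := by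
      have : (u + 1) * s = u * s + s := by ring
      omega
    have h2 : m = (u + 1) * s * (2 * u) := by simp only [m, K]; ring
    have h3 : (u + 1) * s * 2 ≤ (u + 1) * s * (2 * u) := Nat.mul_le_mul_left _ (by omega)
    have h4 : s ≤ (u + 1) * s := Nat.le_mul_of_pos_left _ (by omega)
    omega
  · intro e he
    simp only [cycleGraph, Finset.mem_image, Finset.mem_range] at he
    obtain ⟨i, -, rfl⟩ := he
    rw [Finset.image_image, ← hs]
    apply Finset.eq_univ_of_card
    rw [Finset.card_image_of_injective]
    · simp; omega
    intro j j' hjj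
    simp only [Function.comp_apply, EmbeddingLike.apply_eq_iff_eq, Subtype.mk.injEq,
      ZMod.val_natCast, hper] at hjj
    have hj := j.2
    have hj' := j'.2
    have e1 : ∀ x, (i * s + x) % s = x % s := fun x => by
      rw [add_comm, Nat.add_mul_mod_self_right]
    have e2 : ∀ x, (i * s + x) / s = i + x / s := fun x => by
      rw [add_comm, Nat.add_mul_div_right _ _ hs0, add_comm]
    have d1 := Nat.div_add_mod (j : ℕ) s
    have d2 := Nat.div_add_mod (j' : ℕ) s
    have hb : ∀ x, x < k → x / s < u + 1 := fun x hx => by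
      rw [Nat.div_lt_iff_lt_mul hs0]
      have : (u + 1) * s = u * s + s := by ring
      omega
    have hb' : ∀ x, x < k → ¬ x % s < r → x / s < u := fun x hx hxr => by
      by_contra hcon
      have h1 := Nat.div_add_mod x s
      have h2 : s * u ≤ s * (x / s) := Nat.mul_le_mul_left _ (not_lt.1 hcon)
      rw [mul_comm] at h2
      omega
    have hfin : (j : ℕ) % s = j' % s → (j : ℕ) / s = j' / s → j = j' := by
      intro h1 h2
      rw [h1, h2] at d1
      exact Fin.ext (d1.symm.trans d2)
    simp only [c₀, e1, e2] at hjj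
    by_cases h1 : (j : ℕ) % s < r
    · by_cases h2 : (j' : ℕ) % s < r
      · simp only [h1, h2, if_true, Prod.mk.injEq] at hjj
        refine hfin hjj.1 ?_
        have : (j : ℕ) / s ≡ j' / s [MOD (u + 1)] := Nat.ModEq.add_left_cancel' i hjj.2
        exact Nat.ModEq.eq_of_lt_of_lt this (hb _ hj) (hb _ hj')
      · simp only [h1, h2, if_true, if_false, Prod.mk.injEq] at hjj
        omega
    · by_cases h2 : (j' : ℕ) % s < r
      · simp only [h1, h2, if_true, if_false, Prod.mk.injEq] at hjj
        omega
      · simp only [h1, h2, if_false, Prod.mk.injEq] at hjj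
        refine hfin hjj.1 ?_
        have : (j : ℕ) / s ≡ j' / s [MOD u] := Nat.ModEq.add_left_cancel' i hjj.2
        exact Nat.ModEq.eq_of_lt_of_lt this (hb' _ hj h1) (hb' _ hj' h2)
  · intro i
    have hcount : ((fun p : ZMod m => g.symm ⟨c₀ p.val, hc₀ _⟩) ⁻¹' {Sum.inr i}).ncard
        = 2 * u := by
      rw [← Finset.card_range (2 * u), Set.ncard_eq_toFinset_card']
      have hi := i.2
      have hmQ : m = s * (u + 1) * (2 * u) := by simp only [m, K]; ring
      have hQ : 0 < s * (u + 1) := by positivity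
      have hsi : s * (i : ℕ) < s * (u + 1) := Nat.mul_lt_mul_of_pos_left (by omega) hs0
      have hiff : ∀ p : ZMod m, g.symm ⟨c₀ p.val, hc₀ _⟩ = Sum.inr i ↔
          p.val % (s * (u + 1)) = s * i := by
        intro p
        rw [Equiv.symm_apply_eq, Subtype.ext_iff, hgi]
        have e1 := Nat.mod_mul (x := p.val) (a := s) (b := u + 1)
        simp only [c₀]
        rw [e1]
        constructor
        · intro h
          split_ifs at h with h1
          · simp only [Prod.mk.injEq] at h
            rw [h.1, h.2, zero_add]
          · simp only [Prod.mk.injEq] at h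
            omega
        · intro h
          have h1 : p.val % s = 0 := by
            have := congrArg (· % s) h
            simpa using this
          rw [h1, zero_add] at h
          have h2 := Nat.eq_of_mul_eq_mul_left hs0 h
          rw [h1, if_pos hr, h2]
      refine Finset.card_nbij' (fun p => p.val / (s * (u + 1)))
        (fun q => ((s * (u + 1) * q + s * i : ℕ) : ZMod m)) ?_ ?_ ?_ ?_
      · intro p _
        have := ZMod.val_lt p
        simp only [Finset.coe_range, Set.mem_Iio]
        rw [Nat.div_lt_iff_lt_mul hQ, mul_comm]
        omega
      · intro q hq
        simp only [Finset.coe_range, Set.mem_Iio] at hq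
        simp only [Set.coe_toFinset, Set.mem_preimage, Set.mem_singleton_iff]
        rw [hiff, ZMod.val_natCast, Nat.mod_mod_of_dvd _ ⟨2 * u, hmQ⟩, Nat.mul_add_mod,
          Nat.mod_eq_of_lt hsi]
      · intro p hp
        simp only [Set.coe_toFinset, Set.mem_preimage, Set.mem_singleton_iff] at hp
        rw [hiff] at hp
        dsimp only
        rw [← hp, Nat.div_add_mod, ZMod.natCast_zmod_val]
      · intro q hq
        simp only [Finset.coe_range, Set.mem_Iio] at hq
        dsimp only
        have hlt : s * (u + 1) * q + s * i < m := by
          have : s * (u + 1) * (q + 1) ≤ s * (u + 1) * (2 * u) := Nat.mul_le_mul_left _ hq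
          rw [mul_add, mul_one] at this
          omega
        rw [ZMod.val_natCast, Nat.mod_eq_of_lt hlt, Nat.mul_add_div hQ, Nat.div_eq_of_lt hsi,
          add_zero]
    rw [hcount]
    simp only [m, K]; ring

/-- A set of `d` vertices on which `y` is smallest, in the sense that every other vertex has
weight at least the average over the set. -/
theorem exists_card_eq_sum_le_mul {V : Type*} [Fintype V] [DecidableEq V] (y : V → ℝ) (d : ℕ)
    (hd : d ≤ Fintype.card V) :
    ∃ S : Finset V, S.card = d ∧ ∀ v ∉ S, ∑ u ∈ S, y u ≤ d * y v := by
  obtain ⟨S, hS, hmin⟩ := Finset.exists_min_image (Finset.univ.powersetCard d)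
    (fun S : Finset V => ∑ u ∈ S, y u) (Finset.powersetCard_nonempty.2 (by simpa using hd))
  obtain ⟨-, hc⟩ := Finset.mem_powersetCard.1 hS
  refine ⟨S, hc, fun v hv => ?_⟩
  have h : ∀ u ∈ S, y u ≤ y v := by
    intro u hu
    have hv' : v ∉ S.erase u := fun h => hv (Finset.mem_of_mem_erase h)
    have hpos : 0 < S.card := Finset.card_pos.2 ⟨u, hu⟩
    have := hmin (insert v (S.erase u)) (Finset.mem_powersetCard.2 ⟨Finset.subset_univ _, by
      rw [Finset.card_insert_of_notMem hv', Finset.card_erase_of_mem hu]; omega⟩)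
    rw [Finset.sum_insert hv', ← Finset.add_sum_erase S y hu] at this
    linarith
  have := Finset.sum_le_card_nsmul S y (y v) h
  rwa [hc, nsmul_eq_mul] at this

/-- If `y` has nonnegative weight on all homomorphic images of the `ℓ`-cycle on `m` vertices, then
colouring that cycle by an edge `S ∪ {a, b}` gives a weighted inequality for this edge. -/
theorem weight_inequality_of_rainbow_colouring {k ℓ m n : ℕ} [NeZero m] (hk : 3 ≤ k)
    (hm1 : 2 * k - ℓ ≤ m) (hm2 : (k - ℓ) ∣ m) (c : ZMod m → Fin (k - 2) ⊕ Fin 2)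
    (hc : ∀ e ∈ cycleGraph k ℓ m, e.image c = Finset.univ) (q : ℕ)
    (hq : ∀ i : Fin 2, (c ⁻¹' {Sum.inr i}).ncard = q)
    (E : Finset (Finset (Fin n))) (y : Fin n → ℝ)
    (hy : ∀ φ : ZMod m → Fin n, IsCycleHom k ℓ m E φ → 0 ≤ ∑ p, y (φ p))
    (S : Finset (Fin n)) (hS : S.card = k - 2) (a b : Fin n) (he : S ∪ {a, b} ∈ E) :
    0 ≤ (k - 2 : ℕ) * (q * (y a + y b)) + (m - 2 * q) * ∑ v ∈ S, y v := by
  classical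
  have : NeZero (k - 2) := ⟨by omega⟩
  let f : Fin (k - 2) ≃ S := (S.equivFinOfCardEq hS).symm
  let N : Fin (k - 2) ⊕ Fin 2 → ℝ := fun x => ∑ p, if c p = x then 1 else 0
  have hN : ∀ i : Fin 2, N (Sum.inr i) = q := by
    intro i
    rw [← hq i, Set.ncard_eq_toFinset_card']
    simp only [N, Finset.sum_boole]
    congr 2
    ext p
    simp
  have hNsum : ∑ i, N (Sum.inl i) = m - 2 * q := by
    have h1 : ∑ x, N x = m := by
      simp only [N]
      rw [Finset.sum_comm]
      simp
    rw [Fintype.sum_sum_type, Fin.sum_univ_two, hN, hN] at h1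
    linarith
  have key : ∀ j : Fin (k - 2), 0 ≤ ∑ i, N (Sum.inl i) * y (f (i + j)) + q * (y a + y b) := by
    intro j
    let g : Fin (k - 2) ⊕ Fin 2 → Fin n := Sum.elim (fun i => (f (i + j) : Fin n)) ![a, b]
    have hg : Finset.univ.image g = S ∪ {a, b} := by
      ext v
      simp only [Finset.mem_image, Finset.mem_univ, true_and, Sum.exists, g, Sum.elim_inl,
        Sum.elim_inr, Fin.exists_fin_two, Finset.mem_union, Finset.mem_insert,
        Finset.mem_singleton, Matrix.cons_val_zero, Matrix.cons_val_one]
      refine or_congr ⟨?_, fun hv => ⟨f.symm ⟨v, hv⟩ - j, by simp⟩⟩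
        (or_congr eq_comm eq_comm)
      rintro ⟨i, rfl⟩
      exact (f (i + j)).2
    have h1 := hy (fun p => g (c p)) ⟨hm1, hm2, fun e he' => by
      have : e.image (fun p => g (c p)) = (e.image c).image g := by
        rw [Finset.image_image]; rfl
      rw [this, hc e he', hg]
      exact he⟩
    have h2 : ∑ p, y (g (c p)) = ∑ x, N x * y (g x) := by
      simp only [N, Finset.sum_mul]
      rw [Finset.sum_comm]
      simp
    rw [h2, Fintype.sum_sum_type, Fin.sum_univ_two, hN, hN] at h1
    simp only [g, Sum.elim_inl, Sum.elim_inr, Matrix.cons_val_zero, Matrix.cons_val_one] at h1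
    linarith
  have hsum := Finset.sum_nonneg (s := Finset.univ) (fun j _ => key j)
  rw [Finset.sum_add_distrib, Finset.sum_comm] at hsum
  have h3 : ∀ i, ∑ j, N (Sum.inl i) * y (f (i + j)) = N (Sum.inl i) * ∑ v ∈ S, y v := by
    intro i
    rw [← Finset.mul_sum, ← Finset.sum_coe_sort S y]
    congr 1
    exact Fintype.sum_equiv ((Equiv.addLeft i).trans f) _ _ (fun j => rfl)
  simp only [h3] at hsum
  rw [← Finset.sum_mul, hNsum] at hsum
  simp only [Finset.sum_const, Finset.card_univ, Fintype.card_fin, nsmul_eq_mul] at hsum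
  linarith

/-- The weight inequalities coming from a colouring whose two sparse colours have density `lam`,
together with the degree condition, force a weighting to be nonnegative. -/
theorem sum_nonneg_of_minDegGe {k n : ℕ} (hk : 3 ≤ k) (lam ε : ℝ) (hlam0 : 0 < lam)
    (hlam : lam ≤ 1 / 4) (hε : 0 < ε) (hn4 : 4 * k ≤ n) (hn : 2 * k < ε * (n - k))
    (E : Finset (Finset (Fin n))) (hE : ∀ e ∈ E, e.card = k)
    (hdeg : MinDegGe (k - 2) E ((1 - (1 - lam) ^ 2 + ε) * ((n - (k - 2)).choose 2 : ℝ)))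
    (y : Fin n → ℝ)
    (hy : ∀ (S : Finset (Fin n)) (a b : Fin n), S.card = k - 2 → S ∪ {a, b} ∈ E →
      0 ≤ (k - 2 : ℕ) * (lam * (y a + y b)) + (1 - 2 * lam) * ∑ v ∈ S, y v) :
    0 ≤ ∑ v, y v := by
  classical
  by_contra! hneg
  obtain ⟨S, hS, hmin⟩ := exists_card_eq_sum_le_mul y (k - 2) (by simp; omega)
  set W : Finset (Fin n) := Sᶜ with hW
  have hWc : W.card = n - (k - 2) := by rw [hW, Finset.card_compl, hS, Fintype.card_fin]
  have hd0 : (0 : ℝ) < (k - 2 : ℕ) := Nat.cast_pos.2 (by omega)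
  have hsplit : ∑ v ∈ S, y v + ∑ v ∈ W, y v = ∑ v, y v := Finset.sum_add_sum_compl S y
  have hWS : (W.card : ℝ) * ∑ v ∈ S, y v ≤ (k - 2 : ℕ) * ∑ v ∈ W, y v := by
    have := Finset.card_nsmul_le_sum W (fun v => ((k - 2 : ℕ) : ℝ) * y v) (∑ v ∈ S, y v)
      (fun v hv => hmin v (by simpa [hW] using hv))
    rwa [nsmul_eq_mul, ← Finset.mul_sum] at this
  have hcn : ((k - 2 : ℕ) : ℝ) + W.card = n := by
    rw [hWc]; exact_mod_cast (by omega : k - 2 + (n - (k - 2)) = n)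
  set d : ℝ := ((k - 2 : ℕ) : ℝ) with hd
  obtain ⟨c, hc⟩ : ∃ c, ∑ v ∈ S, y v = -(d * c) := ⟨-(∑ v ∈ S, y v) / d, by field_simp⟩
  have hc0 : 0 < c := by
    by_contra! hcon
    have h1 : 0 ≤ d * -c := mul_nonneg hd0.le (by linarith)
    have h2 : 0 ≤ (W.card : ℝ) * ∑ v ∈ S, y v := mul_nonneg (Nat.cast_nonneg _) (by linarith)
    have h3 : 0 ≤ ∑ v ∈ W, y v := nonneg_of_mul_nonneg_right (h2.trans hWS) hd0
    linarith
  have hdk : d = k - 2 := by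
    rw [hd, Nat.cast_sub (by omega)]; norm_num
  have hkR : (3 : ℝ) ≤ k := by exact_mod_cast hk
  have hnR : 4 * (k : ℝ) ≤ n := by exact_mod_cast hn4
  have hcard := two_mul_card_le_of_fractional_cover W (fun v => lam / c * (y v + c)) (lam * n)
    (by
      intro v hv
      have h1 := hmin v (by simpa [hW] using hv)
      rw [hc] at h1
      have : 0 ≤ y v + c := nonneg_of_mul_nonneg_right (by linarith : 0 ≤ d * (y v + c)) hd0
      positivity)
    (by
      rw [← Finset.mul_sum, Finset.sum_add_distrib, Finset.sum_const, nsmul_eq_mul]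
      have h1 : ∑ v ∈ W, y v + W.card * c < c * n := by
        rw [← hcn]; linarith
      calc _ < lam / c * (c * n) := by
            exact mul_lt_mul_of_pos_left h1 (by positivity)
        _ = lam * n := by field_simp)
    (by nlinarith)
    ((E.filter (fun e => S ⊆ e)).image (fun e => e \ S))
    (by
      intro p hp
      simp only [Finset.mem_image, Finset.mem_filter] at hp
      obtain ⟨e, ⟨heE, hSe⟩, rfl⟩ := hp
      refine Finset.mem_powersetCard.2 ⟨?_, ?_⟩
      · intro v hv
        simp only [Finset.mem_sdiff] at hv
        simp [hW, hv.2]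
      · rw [Finset.card_sdiff_of_subset hSe, hE e heE, hS]; omega)
    (by
      intro a b _ hab
      simp only [Finset.mem_image, Finset.mem_filter] at hab
      obtain ⟨e, ⟨heE, hSe⟩, hes⟩ := hab
      have h1 := hy S a b hS (by rw [← hes, Finset.union_sdiff_of_subset hSe]; exact heE)
      rw [hc] at h1
      have h2 : 0 ≤ lam * (y a + y b) - (1 - 2 * lam) * c :=
        nonneg_of_mul_nonneg_right
          (by linarith : 0 ≤ d * (lam * (y a + y b) - (1 - 2 * lam) * c)) hd0
      have h3 : lam / c * (y a + c) + lam / c * (y b + c)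
          = (lam * (y a + y b) + 2 * lam * c) / c := by field_simp; ring
      rw [h3, le_div_iff₀ hc0]
      linarith)
  rw [Finset.card_image_of_injOn] at hcard
  · have h1 := hdeg S hS
    rw [← hWc, Nat.cast_choose_two] at h1
    generalize ((E.filter (fun e => S ⊆ e)).card : ℝ) = p at *
    have hN : (W.card : ℝ) = n - k + 2 := by linarith
    generalize (W.card : ℝ) = N at *
    have hN0 : 0 < N := by linarith
    have h2 : (1 - (1 - lam) ^ 2 + ε) * (N * (N - 1)) ≤ 2 * (lam * n) * N - (lam * n) ^ 2 := by
      linarith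
    have hnN : (n : ℝ) = N + (k - 2) := by linarith
    have h3 : lam ^ 2 * N ^ 2 ≤ (lam * n) ^ 2 := by
      rw [mul_pow]
      gcongr
      linarith
    have h4 : N * (ε * (N - 1) - (1 - (1 - lam) ^ 2) - 2 * lam * (k - 2)) ≤ 0 := by
      rw [hnN] at h2 h3
      nlinarith
    have h5 : 0 < ε * (N - 1) - (1 - (1 - lam) ^ 2) - 2 * lam * (k - 2) := by
      have : ε * (N - 1) = ε * (n - k) + ε := by rw [hN]; ring
      nlinarith
    exact absurd h4 (not_le.2 (mul_pos hN0 h5))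
  · intro e he e' he' hee
    simp only [Finset.coe_filter, Set.mem_ofPred_eq] at he he'
    dsimp only at hee
    rw [← Finset.union_sdiff_of_subset he.2, hee, Finset.union_sdiff_of_subset he'.2]

/-- **Corollary.** For `k ≥ 3` and `1 ≤ ℓ ≤ k - 2` with `k - ℓ ∤ k`, we have
`δ_{k-2}^{frct}(k,ℓ) ≤ 1 - (1 - λ(k,ℓ))²`. -/
theorem frctThreshold_deg_k_sub_two_le (k ℓ : ℕ) (hk : 3 ≤ k) (hℓ1 : 1 ≤ ℓ)
    (hℓ2 : ℓ ≤ k - 2) (hnd : ¬ (k - ℓ) ∣ k) :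
    frctThreshold k ℓ (k - 2) ≤ 1 - (1 - lam k ℓ) ^ 2 := by
  obtain ⟨s, hs⟩ : ∃ s, s = k - ℓ := ⟨_, rfl⟩
  have hs0 : 0 < s := by omega
  have hr : 0 < k % s := Nat.pos_of_ne_zero fun h => hnd (hs ▸ Nat.dvd_of_mod_eq_zero h)
  have hrs : k % s < s := Nat.mod_lt _ hs0
  have hu : 1 ≤ k / s := Nat.div_pos (by omega) hs0
  have hkur : k = k / s * s + k % s := by rw [mul_comm]; exact (Nat.div_add_mod k s).symm
  generalize k % s = r at hr hrs hkur
  generalize k / s = u at hu hkur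
  have hsR : (0 : ℝ) < s := Nat.cast_pos.2 hs0
  have hceil : ⌈(k : ℝ) / (s : ℝ)⌉₊ = u + 1 := by
    rw [Nat.ceil_eq_iff (by omega), lt_div_iff₀ hsR, div_le_iff₀ hsR]
    constructor
    · exact_mod_cast (by simp; omega : (u + 1 - 1) * s < k)
    · exact_mod_cast (by rw [add_mul]; omega : k ≤ (u + 1) * s)
  have hlam : lam k ℓ = 1 / ((u + 1 : ℝ) * s) := by
    rw [lam, ← hs, hceil]; push_cast; rfl
  have hts : (4 : ℝ) ≤ (u + 1 : ℝ) * s := by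
    exact_mod_cast (by rw [add_mul]; omega : 4 ≤ (u + 1) * s)
  have hlam0 : 0 < lam k ℓ := by rw [hlam]; positivity
  have hlam4 : lam k ℓ ≤ 1 / 4 := by
    rw [hlam]; exact one_div_le_one_div_of_le (by norm_num) hts
  have hlamts : lam k ℓ * ((u + 1 : ℝ) * s) = 1 := by
    rw [hlam]; exact one_div_mul_cancel (by positivity)
  apply csInf_le ⟨0, fun _ h => h.1⟩
  refine ⟨by nlinarith, by nlinarith [sq_nonneg (1 - lam k ℓ)], fun ε hε => ?_⟩
  obtain ⟨m, hm, hm1, hm2, c, hc, hcount⟩ :=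
    exists_rainbow_cycle_colouring k ℓ s u r hk hs hu hr hrs hkur
  have : NeZero m := ⟨hm.ne'⟩
  obtain ⟨n₁, hn₁⟩ := exists_nat_gt (2 * k / ε + k)
  refine ⟨max n₁ (4 * k), fun n hn E hE hdeg => ?_⟩
  have hn4 : 4 * k ≤ n := (le_max_right _ _).trans hn
  have hnε : 2 * k < ε * (n - k) := by
    have h1 : (n₁ : ℝ) ≤ n := by exact_mod_cast (le_max_left _ _).trans hn
    have h2 : 2 * k / ε < n - k := by linarith
    rwa [div_lt_iff₀ hε, mul_comm _ ε] at h2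
  refine perfectFracCycleTiling_of_forall_weight (m := m) (by omega) E fun y hy => ?_
  rw [show k - (k - 2) = 2 by omega] at hdeg
  refine sum_nonneg_of_minDegGe hk (lam k ℓ) ε hlam0 hlam4 hε hn4 hnε E hE hdeg y ?_
  intro S a b hS he
  have hq : ∀ i : Fin 2, (c ⁻¹' {Sum.inr i}).ncard = (c ⁻¹' {Sum.inr 0}).ncard := fun i =>
    Nat.eq_of_mul_eq_mul_right (Nat.mul_pos (Nat.succ_pos u) hs0)
      ((hcount i).trans (hcount 0).symm)
  have h0 := weight_inequality_of_rainbow_colouring hk hm1 hm2 c hc _ hq E y hy S hS a b he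
  have hm0 : ((c ⁻¹' {Sum.inr 0}).ncard : ℝ) * ((u + 1 : ℝ) * s) = m := by
    exact_mod_cast hcount 0
  generalize ((c ⁻¹' {Sum.inr 0}).ncard : ℝ) = q at h0 hm0
  have hmR : (0 : ℝ) < m := Nat.cast_pos.2 hm
  have hqm : q = lam k ℓ * m := by
    rw [← hm0, mul_left_comm, hlamts, mul_one]
  rw [hqm] at h0
  refine nonneg_of_mul_nonneg_right (?_ : 0 ≤ (m : ℝ) * _) hmR
  linarith
end
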